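/- arXiv:1504.00194 — 7 statements merged into one kernel-verified Lean document; each statement's English description precedes it below -/
import Mathlib

section
/- Suppose m = 4, d ∈ F ∖ F₀, and D = (K/F,σ,c) is a division algebra. Then the tensor product algebra A = (L/F₀,σ,c) ⊗_{F₀} (F/F₀,τ,d) is a division algebra if and only if: d ≠ z·τ̃(z)·τ̃²(z)·τ̃³(z) for all z ∈ D, and for all z₀, z₁ ∈ D one has τ̃²(z₁)τ̃³(z₁)z₁ + τ̃²(z₀)z₁ + τ̃²(z₁)τ̃³(z₀) ≠ 0 or τ̃²(z₀)z₀ + τ̃²(z₁)τ̃³(z₁)z₀ ≠ d. -/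
/-!
Setup: `K` is a field, `σ τ : K ≃+* K` are commuting automorphisms of orders `n`, `m`
generating a group of order `n*m` (encoded by `hindep`); `F = Fix σ`, `L = Fix τ`,
`F₀ = Fix σ ∩ Fix τ`, so that `K/F₀` is Galois with group `⟨σ⟩ × ⟨τ⟩`.

`cycMul` is the multiplication of the associative cyclic algebra `D = (K/F,σ,c)` of degree `n`,
realized on `Fin n → K` (the coefficients w.r.t. the right `K`-basis `{1, e, …, e^{n-1}}`),
via `(eⁱ a)(eᵏ b) = e^{(i+k) % n} c^{(i+k)/n} σᵏ(a) b`.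

`tenMul` is the multiplication of the tensor product algebra
`A = (L/F₀,σ,c) ⊗_{F₀} (F/F₀,τ,d)`, realized on `Fin n → Fin m → K`
(the coefficients w.r.t. the `K`-basis `{eⁱ fʲ}`), via
`(eⁱfʲ a)(eᵏfˡ b) = e^{(i+k) % n} f^{(j+l) % m} c^{(i+k)/n} d^{(j+l)/m} σᵏ(τˡ(a)) b`.
-/

/-- Multiplication of the cyclic algebra `(K/F,σ,c)` on coefficients `Fin n → K`. -/
noncomputable def cycMul {K : Type*} [Field K] (n : ℕ) (σ : K ≃+* K) (c : K)
    (x y : Fin n → K) : Fin n → K :=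
  fun r => ∑ i : Fin n, ∑ k : Fin n,
    if ((i : ℕ) + (k : ℕ)) % n = (r : ℕ) then
      c ^ (((i : ℕ) + (k : ℕ)) / n) * (σ ^ (k : ℕ)) (x i) * y k
    else 0

/-- Multiplication of the tensor product algebra `(L/F₀,σ,c) ⊗_{F₀} (F/F₀,τ,d)` on
coefficients `Fin n → Fin m → K`. -/
noncomputable def tenMul {K : Type*} [Field K] (n m : ℕ) (σ τ : K ≃+* K) (c d : K)
    (x y : Fin n → Fin m → K) : Fin n → Fin m → K :=
  fun r s => ∑ i : Fin n, ∑ j : Fin m, ∑ k : Fin n, ∑ l : Fin m,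
    if ((i : ℕ) + (k : ℕ)) % n = (r : ℕ) ∧ ((j : ℕ) + (l : ℕ)) % m = (s : ℕ) then
      c ^ (((i : ℕ) + (k : ℕ)) / n) * d ^ (((j : ℕ) + (l : ℕ)) / m) *
        (σ ^ (k : ℕ)) ((τ ^ (l : ℕ)) (x i j)) * y k l
    else 0

/-- The scalar `d ∈ K` viewed as the element `e⁰ d` of the cyclic algebra. -/
noncomputable def delta0 {K : Type*} [Field K] (n : ℕ) (d : K) : Fin n → K :=
  fun i => if (i : ℕ) = 0 then d else 0

/-- The (left-associated) product `z · τ̃(z) · τ̃²(z) ⋯ τ̃^{j-1}(z)` in the cyclic algebra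
`D = (K/F,σ,c)`, where `τ̃` applies `τ` to each `K`-coefficient. -/
noncomputable def zProd {K : Type*} [Field K] (n : ℕ) (σ τ : K ≃+* K) (c : K)
    (z : Fin n → K) : ℕ → (Fin n → K)
  | 0 => delta0 n 1
  | (j + 1) => cycMul n σ c (zProd n σ τ c z j) (fun i => (τ ^ j) (z i))

section CyclicAlgebra

variable {K : Type*} [Field K]

lemma cycMul_add_left (n : ℕ) (σ : K ≃+* K) (c : K) (x x' y : Fin n → K) :
    cycMul n σ c (x + x') y = cycMul n σ c x y + cycMul n σ c x' y := by
  ext r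
  simp only [cycMul, Pi.add_apply, ← Finset.sum_add_distrib]
  refine Finset.sum_congr rfl fun i _ => Finset.sum_congr rfl fun k _ => ?_
  split_ifs
  · rw [map_add]; ring
  · simp

lemma cycMul_add_right (n : ℕ) (σ : K ≃+* K) (c : K) (x y y' : Fin n → K) :
    cycMul n σ c x (y + y') = cycMul n σ c x y + cycMul n σ c x y' := by
  ext r
  simp only [cycMul, Pi.add_apply, ← Finset.sum_add_distrib]
  refine Finset.sum_congr rfl fun i _ => Finset.sum_congr rfl fun k _ => ?_
  split_ifs
  · ring
  · simp

lemma cycMul_single_single {n : ℕ} (hn : 0 < n) (σ : K ≃+* K) (c : K) (i k : Fin n) (a b : K) :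
    cycMul n σ c (Pi.single i a) (Pi.single k b) =
      Pi.single (⟨(i + k) % n, Nat.mod_lt _ hn⟩ : Fin n)
        (c ^ ((i + k : ℕ) / n) * (σ ^ (k : ℕ)) a * b) := by
  ext r
  rw [cycMul, Finset.sum_eq_single i, Finset.sum_eq_single k]
  · simp only [Pi.single_eq_same, Pi.single_apply, Fin.ext_iff]
    simp only [eq_comm]
  · intro k' _ hk
    simp [Pi.single_eq_of_ne hk]
  · simp
  · intro i' _ hi
    simp [Pi.single_eq_of_ne hi]
  · simp

/-- The multiplication of the cyclic algebra as a biadditive map. -/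
noncomputable def cycMulHom (n : ℕ) (σ : K ≃+* K) (c : K) :
    (Fin n → K) →+ (Fin n → K) →+ (Fin n → K) :=
  AddMonoidHom.mk' (fun x => AddMonoidHom.mk' (cycMul n σ c x) (cycMul_add_right n σ c x))
    fun x x' => AddMonoidHom.ext (cycMul_add_left n σ c x x')

lemma cycMulHom_apply (n : ℕ) (σ : K ≃+* K) (c : K) (x y : Fin n → K) :
    cycMulHom n σ c x y = cycMul n σ c x y := rfl

lemma pow_apply_eq_self {σ : K ≃+* K} {a : K} (h : σ a = a) (k : ℕ) : (σ ^ k) a = a := by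
  induction k with
  | zero => rfl
  | succ k ih => rw [pow_succ, RingAut.mul_apply, h, ih]

lemma cycMul_assoc {n : ℕ} (hn : 0 < n) {σ : K ≃+* K} (hσ : σ ^ n = 1) {c : K} (hc : σ c = c)
    (x y z : Fin n → K) :
    cycMul n σ c (cycMul n σ c x y) z = cycMul n σ c x (cycMul n σ c y z) := by
  have key (i k l : Fin n) (a b e : K) :
      cycMul n σ c (cycMul n σ c (Pi.single i a) (Pi.single k b)) (Pi.single l e) =
        cycMul n σ c (Pi.single i a) (cycMul n σ c (Pi.single k b) (Pi.single l e)) := by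
    simp only [cycMul_single_single hn]
    have hidx : ((i + k : ℕ) % n + l) % n = (i + (k + l : ℕ) % n) % n := by
      rw [Nat.mod_add_mod, Nat.add_mod_mod, add_assoc]
    have hexp : ((i + k : ℕ) % n + l) / n + (i + k : ℕ) / n
        = (i + (k + l : ℕ) % n) / n + (k + l : ℕ) / n := by
      rw [← Nat.add_mul_div_left _ _ hn, ← Nat.add_mul_div_left _ _ hn]
      congr 1
      have h1 := Nat.mod_add_div (i + k : ℕ) n
      have h2 := Nat.mod_add_div (k + l : ℕ) n
      lia
    have hpow : σ ^ ((k + l : ℕ) % n) = σ ^ (l : ℕ) * σ ^ (k : ℕ) := by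
      rw [← pow_add, add_comm (l : ℕ)]
      conv_rhs => rw [← Nat.mod_add_div (k + l : ℕ) n, pow_add, pow_mul, hσ, one_pow, mul_one]
    congr 1
    · exact Fin.ext hidx
    · rw [map_mul, map_mul, map_pow, pow_apply_eq_self hc, hpow, RingAut.mul_apply]
      have := congrArg (c ^ ·) hexp
      simp only [pow_add] at this
      linear_combination ((σ ^ (l : ℕ)) ((σ ^ (k : ℕ)) a) * (σ ^ (l : ℕ)) b * e) * this
  rw [← Finset.univ_sum_single x, ← Finset.univ_sum_single y, ← Finset.univ_sum_single z]
  simp only [← cycMulHom_apply] at key ⊢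
  simp only [map_sum, AddMonoidHom.finsetSum_apply, key]

lemma cycMul_delta0_left {n : ℕ} (hn : 0 < n) {σ : K ≃+* K} (c : K) {a : K} (ha : σ a = a)
    (x : Fin n → K) : cycMul n σ c (delta0 n a) x = a • x := by
  have h0 : delta0 n a = Pi.single (⟨0, hn⟩ : Fin n) a := by
    ext i; simp [delta0, Pi.single_apply, Fin.ext_iff]
  have key (k : Fin n) (b : K) :
      cycMul n σ c (delta0 n a) (Pi.single k b) = a • Pi.single k b := by
    rw [h0, cycMul_single_single hn, pow_apply_eq_self ha, ← Pi.single_smul]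
    congr 1
    · ext; simp [Nat.mod_eq_of_lt k.2]
    · simp [Nat.div_eq_of_lt k.2]
  rw [← Finset.univ_sum_single x]
  simp only [← cycMulHom_apply] at key ⊢
  simp only [map_sum, Finset.smul_sum, key]

lemma cycMul_delta0_right {n : ℕ} (hn : 0 < n) (σ : K ≃+* K) (c a : K)
    (x : Fin n → K) : cycMul n σ c x (delta0 n a) = a • x := by
  have h0 : delta0 n a = Pi.single (⟨0, hn⟩ : Fin n) a := by
    ext i; simp [delta0, Pi.single_apply, Fin.ext_iff]
  have key (k : Fin n) (b : K) :
      cycMul n σ c (Pi.single k b) (delta0 n a) = a • Pi.single k b := by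
    rw [h0, cycMul_single_single hn, ← Pi.single_smul]
    congr 1
    · ext; simp [Nat.mod_eq_of_lt k.2]
    · simp [Nat.div_eq_of_lt k.2, mul_comm]
  rw [← Finset.univ_sum_single x]
  simp only [← cycMulHom_apply] at key ⊢
  simp only [map_sum, AddMonoidHom.finsetSum_apply, Finset.smul_sum, key]

lemma cycMul_smul_right (n : ℕ) (σ : K ≃+* K) (c a : K) (x y : Fin n → K) :
    cycMul n σ c x (a • y) = a • cycMul n σ c x y := by
  ext r
  simp only [cycMul, Pi.smul_apply, smul_eq_mul, Finset.mul_sum]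
  refine Finset.sum_congr rfl fun i _ => Finset.sum_congr rfl fun k _ => ?_
  split_ifs
  · ring
  · simp

lemma map_cycMul (n : ℕ) {σ τ : K ≃+* K} (hcomm : σ * τ = τ * σ) {c : K} (hc : τ c = c)
    (x y : Fin n → K) :
    (fun i => τ (cycMul n σ c x y i)) =
      cycMul n σ c (fun i => τ (x i)) (fun i => τ (y i)) := by
  ext r
  simp only [cycMul, map_sum]
  refine Finset.sum_congr rfl fun i _ => Finset.sum_congr rfl fun k _ => ?_
  split_ifs
  · rw [map_mul, map_mul, map_pow, hc, ← RingAut.mul_apply, ← RingAut.mul_apply,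
      (Commute.pow_left hcomm k).eq]
  · simp

lemma exists_cycMul_eq_one {n : ℕ} (hn : 0 < n) {σ : K ≃+* K} (hσ : σ ^ n = 1) {c : K}
    (hc : σ c = c) (hD : ∀ x y : Fin n → K, x ≠ 0 → y ≠ 0 → cycMul n σ c x y ≠ 0)
    (x : Fin n → K) (hx : x ≠ 0) :
    ∃ y, cycMul n σ c x y = delta0 n 1 ∧ cycMul n σ c y x = delta0 n 1 := by
  let f : (Fin n → K) →ₗ[K] (Fin n → K) :=
    { toFun := cycMul n σ c x
      map_add' := cycMul_add_right n σ c x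
      map_smul' := fun a y => cycMul_smul_right n σ c a x y }
  have hf : Function.Injective f := (injective_iff_map_eq_zero f).2 fun y hy => by
    by_contra h
    exact hD x y hx h hy
  obtain ⟨y, hy⟩ := LinearMap.injective_iff_surjective.1 hf (delta0 n 1)
  refine ⟨y, hy, hf ?_⟩
  change cycMul n σ c x (cycMul n σ c y x) = cycMul n σ c x (delta0 n 1)
  rw [← cycMul_assoc hn hσ hc, show cycMul n σ c x y = delta0 n 1 from hy,
    cycMul_delta0_left hn c (map_one σ), cycMul_delta0_right hn]

/-- Coefficient vectors of the cyclic algebra, without the pointwise product of `Fin n → K`. -/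
def CycAlg (K : Type*) (n : ℕ) : Type _ := Fin n → K

instance (n : ℕ) : AddCommGroup (CycAlg K n) := inferInstanceAs (AddCommGroup (Fin n → K))

/-- The cyclic algebra `(K/F, σ, c)` on coefficient vectors is a ring. -/
noncomputable abbrev cycRing {n : ℕ} (hn : 0 < n) {σ : K ≃+* K} (hσ : σ ^ n = 1) {c : K}
    (hc : σ c = c) : Ring (CycAlg K n) :=
  { (inferInstance : AddCommGroup (CycAlg K n)) with
    mul := cycMul n σ c
    one := delta0 n 1
    mul_assoc := cycMul_assoc hn hσ hc
    one_mul := fun x => (cycMul_delta0_left hn c (map_one σ) x).trans (one_smul K _)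
    mul_one := fun x => (cycMul_delta0_right hn σ c 1 x).trans (one_smul K _)
    left_distrib := cycMul_add_right n σ c
    right_distrib := cycMul_add_left n σ c
    zero_mul := fun x => by
      change cycMulHom n σ c 0 x = 0
      rw [map_zero]
      rfl
    mul_zero := fun x => map_zero (cycMulHom n σ c x) }

/-- A cyclic algebra without zero divisors is a division ring. -/
noncomputable abbrev cycDivisionRing {n : ℕ} (hn : 0 < n) {σ : K ≃+* K} (hσ : σ ^ n = 1) {c : K}
    (hc : σ c = c) (hD : ∀ x y : Fin n → K, x ≠ 0 → y ≠ 0 → cycMul n σ c x y ≠ 0) :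
    DivisionRing (CycAlg K n) :=
  letI := cycRing hn hσ hc
  haveI : Nontrivial (CycAlg K n) := ⟨⟨0, fun _ => 1, fun h =>
    zero_ne_one (congrFun (show (0 : Fin n → K) = fun _ => 1 from h) ⟨0, hn⟩)⟩⟩
  DivisionRing.ofIsUnitOrEqZero fun x => by
    by_cases hx : x = 0
    · exact Or.inr hx
    · obtain ⟨y, hxy, hyx⟩ := exists_cycMul_eq_one hn hσ hc hD x hx
      exact Or.inl ⟨⟨x, y, hxy, hyx⟩, rfl⟩

/-- The ring automorphism `τ̃` of the cyclic algebra, applying `τ` to every coefficient. -/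
noncomputable def cycMap {n : ℕ} (hn : 0 < n) {σ : K ≃+* K} (hσ : σ ^ n = 1) {c : K}
    (hc : σ c = c) (hD : ∀ x y : Fin n → K, x ≠ 0 → y ≠ 0 → cycMul n σ c x y ≠ 0)
    {τ : K ≃+* K} (hcomm : σ * τ = τ * σ) (hcτ : τ c = c) :
    letI := cycDivisionRing hn hσ hc hD
    CycAlg K n →+* CycAlg K n :=
  letI := cycDivisionRing hn hσ hc hD
  { toFun := fun x i => τ (x i)
    map_one' := by
      change (fun i => τ (delta0 n 1 i)) = delta0 n 1
      ext i
      simp only [delta0, apply_ite τ, map_one, map_zero]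
    map_mul' := map_cycMul n hcomm hcτ
    map_zero' := funext fun _ => map_zero τ
    map_add' := fun x y => funext fun i => map_add τ (x i) (y i) }

/-- `tenMul` for `m = 4`, written through the product of the cyclic algebra. -/
lemma tenMul_four_apply (n : ℕ) (σ τ : K ≃+* K) (c d : K) (x y : Fin n → Fin 4 → K)
    (r : Fin n) (s : Fin 4) :
    tenMul n 4 σ τ c d x y r s = ∑ j : Fin 4, ∑ l : Fin 4,
      if ((j : ℕ) + (l : ℕ)) % 4 = (s : ℕ) then
        d ^ (((j : ℕ) + (l : ℕ)) / 4) *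
          cycMul n σ c (fun i => (τ ^ (l : ℕ)) (x i j)) (fun k => y k l) r
      else 0 := by
  have (i : Fin n) : (∑ j : Fin 4, ∑ k : Fin n, ∑ l : Fin 4,
      if ((i : ℕ) + (k : ℕ)) % n = (r : ℕ) ∧ ((j : ℕ) + (l : ℕ)) % 4 = (s : ℕ) then
        c ^ (((i : ℕ) + (k : ℕ)) / n) * d ^ (((j : ℕ) + (l : ℕ)) / 4) *
          (σ ^ (k : ℕ)) ((τ ^ (l : ℕ)) (x i j)) * y k l
      else 0) = ∑ j : Fin 4, ∑ l : Fin 4, ∑ k : Fin n,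
      if ((i : ℕ) + (k : ℕ)) % n = (r : ℕ) ∧ ((j : ℕ) + (l : ℕ)) % 4 = (s : ℕ) then
        c ^ (((i : ℕ) + (k : ℕ)) / n) * d ^ (((j : ℕ) + (l : ℕ)) / 4) *
          (σ ^ (k : ℕ)) ((τ ^ (l : ℕ)) (x i j)) * y k l
      else 0 := Finset.sum_congr rfl fun j _ => Finset.sum_comm
  simp only [tenMul, this]
  rw [Finset.sum_comm]
  refine Finset.sum_congr rfl fun j _ => ?_
  rw [Finset.sum_comm]
  refine Finset.sum_congr rfl fun l _ => ?_
  split_ifs with h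
  · simp only [cycMul, Finset.mul_sum, h, and_true]
    refine Finset.sum_congr rfl fun i _ => Finset.sum_congr rfl fun k _ => ?_
    split_ifs
    · ring
    · simp
  · simp [h]

end CyclicAlgebra

section SkewProduct

variable {D : Type*} [DivisionRing D]

/-- The product of `∑ fʲ xⱼ` and `∑ fˡ yₗ` (`j, l < 4`) subject to `x f = f τ(x)` and `f⁴ = d`. -/
def quarticMul (τ : D →+* D) (d : D) (x y : Fin 4 → D) : Fin 4 → D :=
  ![x 0 * y 0 + d * (τ (x 3) * y 1 + τ (τ (x 2)) * y 2 + τ (τ (τ (x 1))) * y 3),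
    x 1 * y 0 + τ (x 0) * y 1 + d * (τ (τ (x 3)) * y 2 + τ (τ (τ (x 2))) * y 3),
    x 2 * y 0 + τ (x 1) * y 1 + τ (τ (x 0)) * y 2 + d * (τ (τ (τ (x 3))) * y 3),
    x 3 * y 0 + τ (x 2) * y 1 + τ (τ (x 1)) * y 2 + τ (τ (τ (x 0))) * y 3]

/-- The companion operator of `t⁴ - d`, semilinear with respect to `θ`. -/
def companion (θ : D →+* D) (d : D) (v : Fin 4 → D) : Fin 4 → D :=
  ![d * θ (v 3), θ (v 0), θ (v 1), θ (v 2)]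

lemma companion_add (θ : D →+* D) (d : D) (v w : Fin 4 → D) :
    companion θ d (v + w) = companion θ d v + companion θ d w := by
  ext i; fin_cases i <;> simp [companion, mul_add]

lemma companion_smul (θ : D →+* D) {d : D} (hd : ∀ x, d * x = x * d) (a : D) (v : Fin 4 → D) :
    companion θ d (a • v) = θ a • companion θ d v := by
  ext i; fin_cases i <;> simp [companion]
  rw [← mul_assoc, hd, mul_assoc]

lemma companion_mem_span (θ : D →+* D) {d : D} (hd : ∀ x, d * x = x * d) {s : Set (Fin 4 → D)}
    {W : Submodule D (Fin 4 → D)} (hs : ∀ v ∈ s, companion θ d v ∈ W) {v : Fin 4 → D}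
    (hv : v ∈ Submodule.span D s) : companion θ d v ∈ W := by
  induction hv using Submodule.span_induction with
  | mem v hv => exact hs v hv
  | zero =>
    have : companion θ d (0 : Fin 4 → D) = 0 := by ext i; fin_cases i <;> simp [companion]
    rw [this]; exact W.zero_mem
  | add v w _ _ hv hw => rw [companion_add]; exact W.add_mem hv hw
  | smul a v _ hv => rw [companion_smul θ hd]; exact W.smul_mem _ hv

lemma companion_single_zero (θ : D →+* D) (d : D) :
    companion θ d (Pi.single 0 1) = Pi.single 1 1 := by
  ext i; fin_cases i <;> simp [companion]

lemma eq_top_of_single_zero_mem (θ : D →+* D) (d : D) (W : Submodule D (Fin 4 → D))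
    (hW : ∀ v ∈ W, companion θ d v ∈ W) (h : Pi.single 0 1 ∈ W) : W = ⊤ := by
  have h1 : Pi.single 1 1 ∈ W := by
    convert hW _ h using 1; ext i; fin_cases i <;> simp [companion]
  have h2 : Pi.single 2 1 ∈ W := by
    convert hW _ h1 using 1; ext i; fin_cases i <;> simp [companion]
  have h3 : Pi.single 3 1 ∈ W := by
    convert hW _ h2 using 1; ext i; fin_cases i <;> simp [companion]
  refine (Submodule.eq_top_iff').2 fun v => ?_
  have hv : v = v 0 • Pi.single 0 1 + v 1 • Pi.single 1 1 + v 2 • Pi.single 2 1 +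
      v 3 • Pi.single 3 1 := by
    ext i; fin_cases i <;> simp
  rw [hv]
  exact W.add_mem (W.add_mem (W.add_mem (W.smul_mem _ h) (W.smul_mem _ h1)) (W.smul_mem _ h2))
    (W.smul_mem _ h3)

lemma eq_zero_of_smul_mem {V : Type*} [AddCommGroup V] [Module D V] {W : Submodule D V} {v : V}
    (hv : v ∉ W) {a : D} (h : a • v ∈ W) : a = 0 := by
  by_contra ha
  exact hv ((W.smul_mem_iff ha).1 h)

lemma exists_sub_smul_mem_of_sup_eq_top {V : Type*} [AddCommGroup V] [Module D V]
    {W : Submodule D V} {v : V} (h : D ∙ v ⊔ W = ⊤) (w : V) : ∃ z : D, w - z • v ∈ W := by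
  have hw : w ∈ D ∙ v ⊔ W := h ▸ Submodule.mem_top
  obtain ⟨u, hu, w', hw', rfl⟩ := Submodule.mem_sup.1 hw
  obtain ⟨z, rfl⟩ := Submodule.mem_span_singleton.1 hu
  exact ⟨z, by rwa [add_sub_cancel_left]⟩

/-- `t - z` is a right factor of `t⁴ - d` when the companion operator has an invariant
hyperplane. -/
lemma exists_norm_eq_of_finrank_eq_three (θ : D →+* D) {d : D}
    (W : Submodule D (Fin 4 → D)) (hW : ∀ v ∈ W, companion θ d v ∈ W)
    (h3 : Module.finrank D W = 3) : ∃ z, d = θ (θ (θ z)) * θ (θ z) * θ z * z := by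
  have h0 : Pi.single 0 1 ∉ W := fun h => by
    rw [eq_top_of_single_zero_mem θ d W hW h, finrank_top, Module.finrank_fin_fun] at h3
    lia
  have htop : D ∙ (Pi.single 0 1 : Fin 4 → D) ⊔ W = ⊤ := by
    refine Submodule.eq_top_of_finrank_eq ?_
    have hlt : Module.finrank D W < Module.finrank D ↑(D ∙ (Pi.single 0 1 : Fin 4 → D) ⊔ W) :=
      Submodule.finrank_lt_finrank_of_lt <| lt_of_le_of_ne le_sup_right fun h =>
        h0 (h ▸ Submodule.mem_sup_left (Submodule.mem_span_singleton_self _))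
    have hle := Submodule.finrank_le (D ∙ (Pi.single 0 1 : Fin 4 → D) ⊔ W)
    rw [Module.finrank_fin_fun] at *
    lia
  obtain ⟨z, hz⟩ := exists_sub_smul_mem_of_sup_eq_top htop (Pi.single 1 1)
  have hz1 := hW _ hz
  have hz2 := hW _ hz1
  have hz3 := hW _ hz2
  have hmem := W.add_mem (W.add_mem (W.add_mem hz3 (W.smul_mem (θ (θ (θ z))) hz2))
    (W.smul_mem (θ (θ (θ z)) * θ (θ z)) hz1)) (W.smul_mem (θ (θ (θ z)) * θ (θ z) * θ z) hz)
  refine ⟨z, sub_eq_zero.1 (eq_zero_of_smul_mem h0 (a := _) ?_)⟩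
  convert hmem using 1
  ext i
  fin_cases i <;> simp [companion, mul_assoc, sub_eq_add_neg]

/-- `t² - z₁ t - z₀` is a right factor of `t⁴ - d` when the companion operator has an invariant
plane. -/
lemma exists_quadratic_of_finrank_eq_two (θ : D →+* D) {d : D} (hd : ∀ x, d * x = x * d)
    (W : Submodule D (Fin 4 → D)) (hW : ∀ v ∈ W, companion θ d v ∈ W)
    (h2 : Module.finrank D W = 2) :
    ∃ z₀ z₁, θ (θ z₁) * θ z₁ * z₁ + θ (θ z₀) * z₁ + θ (θ z₁) * θ z₀ = 0 ∧
      θ (θ z₀) * z₀ + θ (θ z₁) * θ z₁ * z₀ = d := by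
  have h0 : Pi.single 0 1 ∉ W := fun h => by
    rw [eq_top_of_single_zero_mem θ d W hW h, finrank_top, Module.finrank_fin_fun] at h2
    lia
  have hlt : Module.finrank D W < Module.finrank D ↑(D ∙ (Pi.single 0 1 : Fin 4 → D) ⊔ W) :=
    Submodule.finrank_lt_finrank_of_lt <| lt_of_le_of_ne le_sup_right fun h =>
      h0 (h ▸ Submodule.mem_sup_left (Submodule.mem_span_singleton_self _))
  have h1 : Pi.single 1 1 ∉ D ∙ (Pi.single 0 1 : Fin 4 → D) ⊔ W := fun h => by
    have htop := eq_top_of_single_zero_mem θ d (D ∙ (Pi.single 0 1 : Fin 4 → D) ⊔ W)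
      (fun v hv => by
        obtain ⟨u, hu, w, hw, rfl⟩ := Submodule.mem_sup.1 hv
        obtain ⟨a, rfl⟩ := Submodule.mem_span_singleton.1 hu
        rw [companion_add, companion_smul θ hd, companion_single_zero]
        exact Submodule.add_mem _ (Submodule.smul_mem _ _ h) (Submodule.mem_sup_right (hW w hw)))
      (Submodule.mem_sup_left (Submodule.mem_span_singleton_self _))
    have hle := Submodule.finrank_add_le_finrank_add_finrank (D ∙ (Pi.single 0 1 : Fin 4 → D)) W
    rw [htop, finrank_top, Module.finrank_fin_fun] at hle
    rw [finrank_span_singleton fun h : (Pi.single 0 1 : Fin 4 → D) = 0 => h0 (h ▸ W.zero_mem)] at hle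
    lia
  have htop : D ∙ (Pi.single 1 1 : Fin 4 → D) ⊔ (D ∙ (Pi.single 0 1 : Fin 4 → D) ⊔ W) = ⊤ := by
    refine Submodule.eq_top_of_finrank_eq ?_
    have hlt' := Submodule.finrank_lt_finrank_of_lt <| lt_of_le_of_ne
      (le_sup_right : D ∙ (Pi.single 0 1 : Fin 4 → D) ⊔ W ≤
        D ∙ (Pi.single 1 1 : Fin 4 → D) ⊔ (D ∙ (Pi.single 0 1 : Fin 4 → D) ⊔ W)) fun h =>
        h1 (h ▸ Submodule.mem_sup_left (Submodule.mem_span_singleton_self _))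
    have hle := Submodule.finrank_le
      (D ∙ (Pi.single 1 1 : Fin 4 → D) ⊔ (D ∙ (Pi.single 0 1 : Fin 4 → D) ⊔ W))
    rw [Module.finrank_fin_fun] at *
    lia
  obtain ⟨z₁, hz₁⟩ := exists_sub_smul_mem_of_sup_eq_top htop (Pi.single 2 1)
  obtain ⟨u, hu, w, hw, huw⟩ := Submodule.mem_sup.1 hz₁
  obtain ⟨z₀, rfl⟩ := Submodule.mem_span_singleton.1 hu
  have hz : Pi.single 2 1 - z₁ • Pi.single 1 1 - z₀ • Pi.single 0 1 ∈ W := by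
    rwa [← huw, add_sub_cancel_left]
  have hz1 := hW _ hz
  have hz2 := hW _ hz1
  have hmem := W.add_mem (W.add_mem hz2 (W.smul_mem (θ (θ z₁)) hz1))
    (W.smul_mem (θ (θ z₁) * θ z₁ + θ (θ z₀)) hz)
  have hcomb : (d - (θ (θ z₀) * z₀ + θ (θ z₁) * θ z₁ * z₀)) • (Pi.single 0 1 : Fin 4 → D) -
      (θ (θ z₁) * θ z₁ * z₁ + θ (θ z₀) * z₁ + θ (θ z₁) * θ z₀) • Pi.single 1 1 ∈ W := by
    convert hmem using 1
    ext i
    fin_cases i <;> simp [companion, mul_assoc, add_mul]; abel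
  have hP : θ (θ z₁) * θ z₁ * z₁ + θ (θ z₀) * z₁ + θ (θ z₁) * θ z₀ = 0 := by
    refine eq_zero_of_smul_mem h1 ?_
    rw [← sub_sub_cancel ((d - (θ (θ z₀) * z₀ + θ (θ z₁) * θ z₁ * z₀)) •
      (Pi.single 0 1 : Fin 4 → D)) (_ • Pi.single 1 1)]
    exact Submodule.sub_mem _
      (Submodule.mem_sup_left (Submodule.smul_mem _ _ (Submodule.mem_span_singleton_self _)))
      (Submodule.mem_sup_right hcomb)
  rw [hP, zero_smul, sub_zero] at hcomb
  exact ⟨z₀, z₁, hP, (sub_eq_zero.1 (eq_zero_of_smul_mem h0 hcomb)).symm⟩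

/-- An eigenvector of the companion operator yields a linear factor of `t⁴ - d`. -/
lemma eq_norm_of_companion_eq_smul (θ : D →+* D) (hθ : ∀ x, θ (θ (θ (θ x))) = x) {d z : D}
    {h : Fin 4 → D} (h0 : h ≠ 0) (hz : companion θ d h = z • h) :
    d = z * θ (θ (θ z)) * θ (θ z) * θ z := by
  have e0 : d * θ (h 3) = z * h 0 := congrFun hz 0
  have e1 : θ (h 0) = z * h 1 := congrFun hz 1
  have e2 : θ (h 1) = z * h 2 := congrFun hz 2
  have e3 : θ (h 2) = z * h 3 := congrFun hz 3
  have h3 : h 3 ≠ 0 := fun h3 => by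
    rw [h3, mul_zero, map_eq_zero] at e3
    rw [e3, mul_zero, map_eq_zero] at e2
    rw [e2, mul_zero, map_eq_zero] at e1
    exact h0 (by ext i; fin_cases i <;> assumption)
  have key : h 0 = θ (θ (θ z)) * θ (θ z) * θ z * θ (h 3) := by
    rw [← hθ (h 0), e1, map_mul, e2, map_mul, map_mul, map_mul, e3]
    simp only [map_mul, mul_assoc]
  refine mul_right_cancel₀ ((map_ne_zero θ).2 h3) ?_
  rw [e0, key]
  simp only [mul_assoc]

/-- A nonzero vector that is not cyclic for the companion operator lies in a proper invariant
subspace. -/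
lemma exists_invariant_submodule (θ : D →+* D) {d : D} (hd : ∀ x, d * x = x * d)
    {h a : Fin 4 → D} (h0 : h ≠ 0) (ha : a ≠ 0)
    (hrel : a 0 • h + a 1 • companion θ d h + a 2 • companion θ d (companion θ d h) +
      a 3 • companion θ d (companion θ d (companion θ d h)) = 0) :
    ∃ W : Submodule D (Fin 4 → D), (∀ v ∈ W, companion θ d v ∈ W) ∧ h ∈ W ∧
      Module.finrank D W ≤ 3 := by
  set T := companion θ d with hT
  by_cases h3 : a 3 = 0
  · by_cases h2 : a 2 = 0
    · by_cases h1 : a 1 = 0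
      · exfalso
        simp only [h1, h2, h3, zero_smul, add_zero, smul_eq_zero, h0, or_false] at hrel
        exact ha (by ext i; fin_cases i <;> assumption)
      · refine ⟨Submodule.span D (Set.range ![h]), fun v hv => ?_,
          Submodule.subset_span ⟨0, rfl⟩, (finrank_range_le_card _).trans (by simp)⟩
        have m0 : h ∈ Submodule.span D (Set.range ![h]) := Submodule.subset_span ⟨0, rfl⟩
        refine companion_mem_span θ hd ?_ hv
        rintro _ ⟨i, rfl⟩
        fin_cases i
        refine (Submodule.smul_mem_iff _ h1).1 ?_
        have : a 1 • T h = -(a 0 • h) := by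
          simp only [h2, h3, zero_smul, add_zero] at hrel
          exact eq_neg_of_add_eq_zero_right hrel
        exact this ▸ Submodule.neg_mem _ (Submodule.smul_mem _ _ m0)
    · have m0 : h ∈ Submodule.span D (Set.range ![h, T h]) := Submodule.subset_span ⟨0, rfl⟩
      have m1 : T h ∈ Submodule.span D (Set.range ![h, T h]) := Submodule.subset_span ⟨1, rfl⟩
      refine ⟨Submodule.span D (Set.range ![h, T h]), fun v hv => ?_, m0,
        (finrank_range_le_card _).trans (by simp)⟩
      refine companion_mem_span θ hd ?_ hv
      rintro _ ⟨i, rfl⟩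
      fin_cases i
      · exact m1
      · refine (Submodule.smul_mem_iff _ h2).1 ?_
        have : a 2 • T (T h) = -(a 0 • h + a 1 • T h) := by
          simp only [h3, zero_smul, add_zero] at hrel
          exact eq_neg_of_add_eq_zero_right hrel
        exact this ▸ Submodule.neg_mem _
          (Submodule.add_mem _ (Submodule.smul_mem _ _ m0) (Submodule.smul_mem _ _ m1))
  · have m0 : h ∈ Submodule.span D (Set.range ![h, T h, T (T h)]) :=
      Submodule.subset_span ⟨0, rfl⟩
    have m1 : T h ∈ Submodule.span D (Set.range ![h, T h, T (T h)]) :=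
      Submodule.subset_span ⟨1, rfl⟩
    have m2 : T (T h) ∈ Submodule.span D (Set.range ![h, T h, T (T h)]) :=
      Submodule.subset_span ⟨2, rfl⟩
    refine ⟨Submodule.span D (Set.range ![h, T h, T (T h)]), fun v hv => ?_, m0,
      (finrank_range_le_card _).trans (by simp)⟩
    refine companion_mem_span θ hd ?_ hv
    rintro _ ⟨i, rfl⟩
    fin_cases i
    · exact m1
    · exact m2
    · refine (Submodule.smul_mem_iff _ h3).1 ?_
      have : a 3 • T (T (T h)) = -(a 0 • h + a 1 • T h + a 2 • T (T h)) :=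
        eq_neg_of_add_eq_zero_right hrel
      exact this ▸ Submodule.neg_mem _ (Submodule.add_mem _
        (Submodule.add_mem _ (Submodule.smul_mem _ _ m0) (Submodule.smul_mem _ _ m1))
        (Submodule.smul_mem _ _ m2))

/-- Moving the coefficients to the left of the powers of `t` turns `quarticMul` into a combination
of iterates of the companion operator. -/
lemma sum_smul_companion_eq (τ : D →+* D) (hτ : ∀ x, τ (τ (τ (τ x))) = x) {d : D}
    (hd : ∀ x, d * x = x * d) (x y : Fin 4 → D) :
    let T := companion ((τ.comp τ).comp τ) d
    let h : Fin 4 → D := ![y 0, τ (τ (τ (y 1))), τ (τ (y 2)), τ (y 3)]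
    x 0 • h + τ (τ (τ (x 1))) • T h + τ (τ (x 2)) • T (T h) + τ (x 3) • T (T (T h)) =
      ![quarticMul τ d x y 0, τ (τ (τ (quarticMul τ d x y 1))), τ (τ (quarticMul τ d x y 2)),
        τ (quarticMul τ d x y 3)] := by
  have hd0 (u v : D) : u * (d * v) = d * (u * v) := by rw [← mul_assoc, ← hd, mul_assoc]
  have hd2 (u v : D) : u * (τ (τ d) * v) = τ (τ d) * (u * v) := by
    rw [← hτ u, ← hτ v]; simp only [← map_mul, hd0]
  have hd3 (u v : D) : u * (τ (τ (τ d)) * v) = τ (τ (τ d)) * (u * v) := by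
    rw [← hτ u, ← hτ v]; simp only [← map_mul, hd0]
  intro T h
  ext i
  fin_cases i <;> simp [T, h, companion, quarticMul, hτ, hd0, hd2, hd3, mul_add] <;> abel

/-- `quarticMul` has no zero divisors iff `t⁴ - d` has neither a linear nor
a quadratic right factor. -/
theorem quarticMul_ne_zero_iff (τ : D →+* D) (hτ : ∀ x, τ (τ (τ (τ x))) = x) (d : D)
    (hd : ∀ x, d * x = x * d) :
    (∀ x y, x ≠ 0 → y ≠ 0 → quarticMul τ d x y ≠ 0) ↔
      ((∀ z, d ≠ z * τ z * τ (τ z) * τ (τ (τ z))) ∧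
        ∀ z₀ z₁, τ (τ z₁) * τ (τ (τ z₁)) * z₁ + τ (τ z₀) * z₁ + τ (τ z₁) * τ (τ (τ z₀)) ≠ 0 ∨
          τ (τ z₀) * z₀ + τ (τ z₁) * τ (τ (τ z₁)) * z₀ ≠ d) := by
  constructor
  · refine fun H => ⟨fun z hz => ?_, fun z₀ z₁ => ?_⟩
    · refine H ![-z, 1, 0, 0] ![τ z * τ (τ z) * τ (τ (τ z)),
        τ (τ z) * τ (τ (τ z)), τ (τ (τ z)), 1] (fun h => ?_)
        (fun h => ?_) ?_
      · simpa using congrFun h 1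
      · simpa using congrFun h 3
      · ext i
        fin_cases i <;> simp [quarticMul, mul_assoc]
        rw [hz]
        simp only [mul_assoc, neg_add_cancel]
    · by_contra! hcon
      obtain ⟨h1, h2⟩ := hcon
      refine H ![τ (τ z₁) * τ (τ (τ z₁)) + τ (τ z₀), τ (τ (τ z₁)), 1, 0] ![-z₀, -τ z₁, 1, 0]
        (fun h => ?_) (fun h => ?_) ?_
      · simpa using congrFun h 2
      · simpa using congrFun h 2
      · have h1' := congrArg τ h1
        simp only [map_add, map_mul, hτ, map_zero] at h1'
        ext i
        fin_cases i
        · simp only [quarticMul, Fin.zero_eta, Matrix.cons_val, map_zero, map_one, zero_mul,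
            mul_neg, mul_one, mul_zero, add_zero, Pi.zero_apply]
          rw [← h2, add_mul, neg_zero, zero_add, mul_one]
          abel
        · simp [quarticMul, hτ, add_mul]
          rw [← neg_eq_zero, ← h1']
          simp only [mul_assoc]
          abel
        · simp [quarticMul, hτ]
        · simp [quarticMul, hτ]
  · rintro ⟨H1, H2⟩ x y hx hy hxy
    set θ := (τ.comp τ).comp τ with hθdef
    have hθ (u : D) : θ (θ (θ (θ u))) = u := by simp [hθdef, hτ]
    have hrel := sum_smul_companion_eq τ hτ hd x y
    simp only [hxy] at hrel
    obtain ⟨W, hW, hmem, hle⟩ := exists_invariant_submodule θ hd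
      (h := ![y 0, τ (τ (τ (y 1))), τ (τ (y 2)), τ (y 3)])
      (a := ![x 0, τ (τ (τ (x 1))), τ (τ (x 2)), τ (x 3)])
      (fun h => hy (by
        ext i
        have := congrFun h i
        fin_cases i <;> simpa using this))
      (fun h => hx (by
        ext i
        have := congrFun h i
        fin_cases i <;> simpa using this))
      (hrel.trans (by ext i; fin_cases i <;> simp))
    set h : Fin 4 → D := ![y 0, τ (τ (τ (y 1))), τ (τ (y 2)), τ (y 3)] with hh
    have hne : h ≠ 0 := fun h' => hy (by
        ext i
        have := congrFun h' i
        fin_cases i <;> simpa [hh] using this)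
    have hpos : 0 < Module.finrank D W :=
      Module.finrank_pos_iff_exists_ne_zero.2 ⟨⟨h, hmem⟩, fun h' => hne (congrArg Subtype.val h')⟩
    obtain h1 | h2 | h3 : Module.finrank D W = 1 ∨ Module.finrank D W = 2 ∨
      Module.finrank D W = 3 := by lia
    · obtain ⟨z, hz⟩ := (finrank_eq_one_iff_of_nonzero' (⟨h, hmem⟩ : W)
        fun h' => hne (congrArg Subtype.val h')).1 h1 ⟨_, hW h hmem⟩
      have := eq_norm_of_companion_eq_smul θ hθ hne (congrArg Subtype.val hz).symm
      exact H1 z (by simpa [hθdef, hτ] using this)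
    · obtain ⟨z₀, z₁, hz₁, hz₀⟩ := exists_quadratic_of_finrank_eq_two θ hd W hW h2
      simp only [hθdef, RingHom.comp_apply, hτ] at hz₁ hz₀
      exact (H2 z₀ z₁).elim (· hz₁) (· hz₀)
    · obtain ⟨z, hz⟩ := exists_norm_eq_of_finrank_eq_three θ W hW h3
      exact H1 (τ z) (by simpa [hθdef, hτ] using hz)

end SkewProduct

/-- Suppose `m = 4`, `d ∈ F ∖ F₀`, and `D = (K/F,σ,c)` is a division algebra.
Then `A = (L/F₀,σ,c) ⊗_{F₀} (F/F₀,τ,d)` is a division algebra iff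
`d ≠ z·τ̃(z)·τ̃²(z)·τ̃³(z)` for all `z ∈ D`, and for all `z₀, z₁ ∈ D` one has
`τ̃²(z₁)τ̃³(z₁)z₁ + τ̃²(z₀)z₁ + τ̃²(z₁)τ̃³(z₀) ≠ 0` or
`τ̃²(z₀)z₀ + τ̃²(z₁)τ̃³(z₁)z₀ ≠ d` (products taken in `D`). -/
theorem tensor_division_iff_degree_four {K : Type*} [Field K] (n : ℕ) (hn : 0 < n)
    (σ τ : K ≃+* K) (hσord : orderOf σ = n) (hτord : orderOf τ = 4)
    (hcomm : σ * τ = τ * σ)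
    (hindep : ∀ i j : ℕ, i < n → j < 4 → σ ^ i * τ ^ j = 1 → i = 0 ∧ j = 0)
    (c : K) (hc0 : c ≠ 0) (hcσ : σ c = c) (hcτ : τ c = c)
    (d : K) (hd0 : d ≠ 0) (hdσ : σ d = d) (hdτ : τ d ≠ d)
    (hD : ∀ x y : Fin n → K, x ≠ 0 → y ≠ 0 → cycMul n σ c x y ≠ 0) :
    (∀ x y : Fin n → Fin 4 → K, x ≠ 0 → y ≠ 0 → tenMul n 4 σ τ c d x y ≠ 0) ↔
      ((∀ z : Fin n → K, delta0 n d ≠ zProd n σ τ c z 4) ∧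
        ∀ z₀ z₁ : Fin n → K,
          cycMul n σ c (cycMul n σ c (fun i => (τ ^ 2) (z₁ i)) (fun i => (τ ^ 3) (z₁ i))) z₁
              + cycMul n σ c (fun i => (τ ^ 2) (z₀ i)) z₁
              + cycMul n σ c (fun i => (τ ^ 2) (z₁ i)) (fun i => (τ ^ 3) (z₀ i)) ≠ 0 ∨
          cycMul n σ c (fun i => (τ ^ 2) (z₀ i)) z₀
              + cycMul n σ c
                  (cycMul n σ c (fun i => (τ ^ 2) (z₁ i)) (fun i => (τ ^ 3) (z₁ i))) z₀
            ≠ delta0 n d) := by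
  have hσ : σ ^ n = 1 := hσord ▸ pow_orderOf_eq_one σ
  have hτ4 (a : K) : τ (τ (τ (τ a))) = a := by
    have h : τ ^ 4 = 1 := hτord ▸ pow_orderOf_eq_one τ
    exact congrArg (fun f : K ≃+* K => f a) h
  let _ := cycDivisionRing hn hσ hcσ hD
  let T : CycAlg K n →+* CycAlg K n := cycMap hn hσ hcσ hD hcomm hcτ
  have hmul (u v : CycAlg K n) (r : Fin n) : (u * v) r = cycMul n σ c u v r := rfl
  have hT₁ (u v : CycAlg K n) (r : Fin n) :
      (T u * v) r = cycMul n σ c (fun i => τ (u i)) v r := rfl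
  have hT₂ (u v : CycAlg K n) (r : Fin n) :
      (T (T u) * v) r = cycMul n σ c (fun i => τ (τ (u i))) v r := rfl
  have hT₃ (u v : CycAlg K n) (r : Fin n) :
      (T (T (T u)) * v) r = cycMul n σ c (fun i => τ (τ (τ (u i)))) v r := rfl
  let δ : CycAlg K n := delta0 n d
  have key := quarticMul_ne_zero_iff T (fun x => funext fun i => hτ4 (x i)) δ
    fun x => (cycMul_delta0_left hn c hdσ x).trans (cycMul_delta0_right hn σ c d x).symm
  have hδ (x : CycAlg K n) (r : Fin n) : (δ * x) r = d * x r :=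
    congrFun (cycMul_delta0_left hn c hdσ x) r
  have hadd (u v : CycAlg K n) (r : Fin n) : (u + v) r = u r + v r := rfl
  have hprod (x y : Fin 4 → CycAlg K n) :
      quarticMul T δ x y =
        fun s r => tenMul n 4 σ τ c d (fun i j => x j i) (fun i j => y j i) r s := by
    funext s r
    rw [tenMul_four_apply]
    fin_cases s <;> simp [Fin.sum_univ_four, quarticMul, hadd, hδ, pow_succ, mul_add] <;>
      simp only [hT₃, hT₂] <;> simp only [hT₁] <;> simp only [hmul] <;> ring
  refine Iff.trans ⟨fun H x y hx hy h => ?_, fun H x y hx hy h => ?_⟩ (key.trans ?_)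
  · refine H (fun i s => x s i) (fun i s => y s i) (fun h' => hx ?_) (fun h' => hy ?_) ?_
    · exact funext fun s => funext fun i => congrFun (congrFun h' i) s
    · exact funext fun s => funext fun i => congrFun (congrFun h' i) s
    · rw [hprod] at h
      exact funext fun i => funext fun s => congrFun (congrFun h s) i
  · refine H (fun s i => x i s) (fun s i => y i s) (fun h' => hx ?_) (fun h' => hy ?_) ?_
    · exact funext fun i => funext fun s => congrFun (congrFun h' s) i
    · exact funext fun i => funext fun s => congrFun (congrFun h' s) i
    · refine (hprod _ _).trans (funext fun s => funext fun r => ?_)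
      exact congrFun (congrFun h r) s
  · refine and_congr (forall_congr' fun z => ?_) Iff.rfl
    have h1 : cycMul n σ c (delta0 n 1) (fun i => (τ ^ 0) (z i)) = z :=
      (cycMul_delta0_left hn c (map_one σ) _).trans (one_smul K _)
    simp only [zProd, h1]
    exact Iff.rfl
end

section
/- Suppose d ∈ F ∖ F₀, D = (K/F,σ,c) is a division algebra, m is prime, and, in case m ≠ 2 and m ≠ 3, F₀ contains a primitive m-th root of unity. If τ(dⁿ) ≠ dⁿ, then the tensor product algebra A = (L/F₀,σ,c) ⊗_{F₀} (F/F₀,τ,d) is a division algebra. -/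
section WrapShift

variable {K M : Type*} [Field K] [AddCommGroup M] [Module K M]

/-- The `K`-linear operator on `Fin n → M` moving index `i` to `i + 1`, with the index `n` folded
back to `0` at the cost of a factor `c`. -/
noncomputable def wrapShift (n : ℕ) (c : K) : Module.End K (Fin n → M) where
  toFun v r := ∑ i : Fin n, if ((i : ℕ) + 1) % n = (r : ℕ) then c ^ (((i : ℕ) + 1) / n) • v i else 0
  map_add' v w := by
    funext r
    simp only [Pi.add_apply, smul_add, ← Finset.sum_add_distrib]
    exact Finset.sum_congr rfl fun i _ => by split_ifs <;> simp
  map_smul' a v := by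
    funext r
    simp only [Pi.smul_apply, RingHom.id_apply, Finset.smul_sum, smul_ite, smul_zero]
    exact Finset.sum_congr rfl fun i _ => by rw [smul_comm]

theorem wrapShift_apply (n : ℕ) (c : K) (v : Fin n → M) (r : Fin n) :
    wrapShift n c v r =
      ∑ i : Fin n, if ((i : ℕ) + 1) % n = (r : ℕ) then c ^ (((i : ℕ) + 1) / n) • v i else 0 := rfl

theorem wrapShift_pow_apply (n : ℕ) (c : K) (k : ℕ) (v : Fin n → M) (r : Fin n) :
    (wrapShift n c ^ k) v r =
      ∑ i : Fin n, if ((i : ℕ) + k) % n = (r : ℕ) then c ^ (((i : ℕ) + k) / n) • v i else 0 := by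
  induction k generalizing v r with
  | zero =>
    have h (i : Fin n) : ((i : ℕ) = (r : ℕ)) ↔ i = r := Fin.ext_iff.symm
    simp [Nat.mod_eq_of_lt, Nat.div_eq_of_lt, h]
  | succ k ih =>
    rw [pow_succ, Module.End.mul_apply, ih]
    simp only [wrapShift_apply, Finset.smul_sum]
    have h (i : Fin n) : (if ((i : ℕ) + k) % n = (r : ℕ) then ∑ j : Fin n, c ^ (((i : ℕ) + k) / n) •
          (if ((j : ℕ) + 1) % n = (i : ℕ) then c ^ (((j : ℕ) + 1) / n) • v j else 0) else 0) =
        ∑ j : Fin n, if ((j : ℕ) + 1) % n = (i : ℕ) then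
          (if ((i : ℕ) + k) % n = (r : ℕ) then
            c ^ (((i : ℕ) + k) / n) • c ^ (((j : ℕ) + 1) / n) • v j else 0) else 0 := by
      split_ifs with hi
      · exact Finset.sum_congr rfl fun j _ => by split_ifs <;> simp
      · simp
    rw [Finset.sum_congr rfl fun i _ => h i, Finset.sum_comm]
    refine Finset.sum_congr rfl fun j _ => ?_
    have hn : 0 < n := j.pos
    rw [Finset.sum_eq_single (⟨((j : ℕ) + 1) % n, Nat.mod_lt _ hn⟩ : Fin n)]
    · have h1 : (((j : ℕ) + 1) % n + k) % n = ((j : ℕ) + (k + 1)) % n := by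
        rw [Nat.mod_add_mod]; congr 1; ring
      have h2 : (((j : ℕ) + 1) % n + k) / n + ((j : ℕ) + 1) / n = ((j : ℕ) + (k + 1)) / n := by
        rw [← Nat.add_mul_div_left _ _ hn]
        congr 1
        have := Nat.mod_add_div ((j : ℕ) + 1) n
        omega
      simp only [if_true, h1, smul_smul, ← pow_add, h2]
    · intro b _ hb
      rw [if_neg]
      exact fun h => hb (Fin.ext h.symm)
    · simp

theorem wrapShift_pow_self (n : ℕ) (c : K) : (wrapShift n c : Module.End K (Fin n → M)) ^ n =
    c • 1 := by
  refine LinearMap.ext fun v => funext fun r => ?_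
  have h (i : Fin n) : ((i : ℕ) = (r : ℕ)) ↔ i = r := Fin.ext_iff.symm
  have hn : 0 < n := r.pos
  simp [wrapShift_pow_apply, Nat.mod_eq_of_lt, Nat.add_div_right _ hn, Nat.div_eq_of_lt, h]

end WrapShift

/-- An additive endomorphism of `ι → K` that is linear for a diagonally twisted `K`-action is
injective if and only if it is surjective. -/
theorem injective_iff_surjective_of_twisted {K ι V : Type*} [Field K] [Finite ι] [AddCommGroup V]
    (e : V ≃+ (ι → K)) (θ : ι → K ≃+* K) (f : V →+ V)
    (hf : ∀ (a : K) (v w : V), (∀ i, e w i = θ i a * e v i) →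
      ∀ i, e (f w) i = θ i a * e (f v) i) :
    Function.Injective f ↔ Function.Surjective f := by
  let t : (ι → K) ≃ V := (Equiv.piCongrRight fun i => (θ i).toEquiv).trans e.symm.toEquiv
  have ht (α : ι → K) (i : ι) : e (t α) i = θ i (α i) := by simp [t]
  have ht' (v : V) (i : ι) : t.symm v i = (θ i).symm (e v i) := rfl
  let g : (ι → K) →ₗ[K] (ι → K) :=
    { toFun := t.symm ∘ f ∘ t
      map_add' := fun α β => by
        have : t (α + β) = t α + t β := e.injective (funext fun i => by simp [ht])
        funext i
        simp [this, ht']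
      map_smul' := fun a α => by
        funext i
        have := hf a (t α) (t (a • α)) (fun i => by simp [ht]) i
        simp [this, ht'] }
  have hg : ⇑g = t.symm ∘ f ∘ t := rfl
  have := LinearMap.injective_iff_surjective (f := g)
  rwa [hg, Equiv.comp_injective, Equiv.injective_comp, Equiv.comp_surjective,
    Equiv.surjective_comp] at this

section Operators

variable {K : Type*} [Field K]

theorem pow_apply_eq_of_mod_eq {σ : K ≃+* K} {n i r : ℕ} (h : orderOf σ = n) (hi : i % n = r)
    (a : K) : (σ ^ r) a = (σ ^ i) a := by
  rw [← hi, ← h, pow_mod_orderOf]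

theorem pow_apply_pow_comm {σ τ : K ≃+* K} (h : σ * τ = τ * σ) (i j : ℕ) (a : K) :
    (σ ^ i) ((τ ^ j) a) = (τ ^ j) ((σ ^ i) a) :=
  DFunLike.congr_fun ((show Commute σ τ from h).pow_pow i j).eq a

theorem pow_apply_fixed {σ : K ≃+* K} {a : K} (h : σ a = a) (i : ℕ) : (σ ^ i) a = a := by
  induction i with
  | zero => rfl
  | succ i ih => rw [pow_succ, RingAut.mul_apply, h, ih]

theorem prime_pow_apply_ne {τ : K ≃+* K} {m : ℕ} (hm : m.Prime) (hτ : orderOf τ = m) {d : K}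
    (hd : τ d ≠ d) {k : ℕ} (hk : ¬ m ∣ k) : (τ ^ k) d ≠ d := by
  intro h
  have key (j : ℕ) : (τ ^ j) d = τ^[j] d := by
    induction j with
    | zero => rfl
    | succ j ih => rw [pow_succ', RingAut.mul_apply, ih, Function.iterate_succ_apply']
  have h1 : Function.IsPeriodicPt τ k d := (key k).symm.trans h
  have h2 : Function.IsPeriodicPt τ m d := by
    refine (key m).symm.trans ?_
    rw [← hτ, pow_orderOf_eq_one]; rfl
  have h3 := h2.gcd h1
  rw [(hm.coprime_iff_not_dvd).mpr hk] at h3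
  exact hd h3

variable {n m : ℕ}

/-- Left multiplication by `a ∈ K` on the algebra with basis `eⁱfʲ`. -/
noncomputable def scalarOp (n m : ℕ) (σ τ : K ≃+* K) :
    K →+* Module.End K (Fin n → Fin m → K) where
  toFun a :=
    { toFun := fun v i s => (σ ^ (i : ℕ)) ((τ ^ (s : ℕ)) a) * v i s
      map_add' := fun v w => by funext i s; simp [mul_add]
      map_smul' := fun b v => by funext i s; simp [mul_left_comm] }
  map_one' := by ext; simp
  map_mul' a b := LinearMap.ext fun v => by funext i s; simp [mul_assoc]
  map_zero' := by ext; simp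
  map_add' a b := LinearMap.ext fun v => by funext i s; simp [add_mul]

theorem scalarOp_apply (σ τ : K ≃+* K) (a : K) (v : Fin n → Fin m → K) (i : Fin n) (s : Fin m) :
    scalarOp n m σ τ a v i s = (σ ^ (i : ℕ)) ((τ ^ (s : ℕ)) a) * v i s := rfl

/-- Left multiplication by `e` on the algebra with basis `eⁱfʲ`. -/
noncomputable def eOp (n m : ℕ) (c : K) : Module.End K (Fin n → Fin m → K) := wrapShift n c

/-- Left multiplication by `f` on the algebra with basis `eⁱfʲ`. -/
noncomputable def fOp (n m : ℕ) (d : K) : Module.End K (Fin n → Fin m → K) :=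
  (wrapShift m d).compLeft (Fin n)

theorem fOp_pow_apply (d : K) (k : ℕ) (v : Fin n → Fin m → K) (i : Fin n) :
    (fOp n m d ^ k) v i = (wrapShift m d ^ k) (v i) := by
  induction k generalizing v with
  | zero => rfl
  | succ k ih => rw [pow_succ, pow_succ, Module.End.mul_apply, ih]; rfl

theorem eOp_pow_apply (c : K) (k : ℕ) (v : Fin n → Fin m → K) (r : Fin n) (s : Fin m) :
    (eOp n m c ^ k) v r s =
      ∑ i : Fin n, if ((i : ℕ) + k) % n = (r : ℕ) then c ^ (((i : ℕ) + k) / n) * v i s else 0 := by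
  rw [eOp, wrapShift_pow_apply, Finset.sum_apply]
  exact Finset.sum_congr rfl fun i _ => by split_ifs <;> simp

theorem commute_eOp_fOp (c d : K) : Commute (eOp n m c) (fOp n m d) := by
  refine LinearMap.ext fun v => funext fun r => ?_
  have h (w : Fin n → Fin m → K) (i : Fin n) : fOp n m d w i = wrapShift m d (w i) := rfl
  rw [Module.End.mul_apply, Module.End.mul_apply, h, eOp, wrapShift_apply, wrapShift_apply, map_sum]
  exact Finset.sum_congr rfl fun i _ => by split_ifs <;> simp [h]

theorem fOp_pow_self_apply (d : K) (v : Fin n → Fin m → K) (i : Fin n) (s : Fin m) :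
    (fOp n m d ^ m) v i s = d * v i s := by
  rw [fOp_pow_apply, wrapShift_pow_self]; rfl

variable {σ τ : K ≃+* K}

theorem eOp_pow_self {c : K} (hcσ : σ c = c) (hcτ : τ c = c) :
    eOp n m c ^ n = scalarOp n m σ τ c := by
  rw [eOp, wrapShift_pow_self]
  refine LinearMap.ext fun v => funext fun r => funext fun s => ?_
  rw [scalarOp_apply, pow_apply_fixed hcτ, pow_apply_fixed hcσ]; rfl

theorem scalarOp_mul_eOp_pow (hσ : orderOf σ = n) (hcomm : σ * τ = τ * σ) (c a : K) (k : ℕ) :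
    scalarOp n m σ τ a * eOp n m c ^ k = eOp n m c ^ k * scalarOp n m σ τ ((σ ^ k) a) := by
  refine LinearMap.ext fun v => funext fun r => funext fun s => ?_
  rw [Module.End.mul_apply, Module.End.mul_apply, scalarOp_apply, eOp_pow_apply, eOp_pow_apply,
    Finset.mul_sum]
  refine Finset.sum_congr rfl fun i _ => ?_
  split_ifs with h
  · rw [scalarOp_apply, pow_apply_eq_of_mod_eq hσ h, pow_add, RingAut.mul_apply,
      ← pow_apply_pow_comm hcomm k]
    ring
  · simp

theorem scalarOp_mul_fOp_pow (hτ : orderOf τ = m) (d a : K) (k : ℕ) :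
    scalarOp n m σ τ a * fOp n m d ^ k = fOp n m d ^ k * scalarOp n m σ τ ((τ ^ k) a) := by
  refine LinearMap.ext fun v => funext fun r => funext fun s => ?_
  rw [Module.End.mul_apply, Module.End.mul_apply, scalarOp_apply, fOp_pow_apply, fOp_pow_apply,
    wrapShift_pow_apply, wrapShift_pow_apply, Finset.mul_sum]
  refine Finset.sum_congr rfl fun i _ => ?_
  split_ifs with h
  · rw [scalarOp_apply, pow_apply_eq_of_mod_eq hτ h, pow_add, RingAut.mul_apply, smul_eq_mul,
      smul_eq_mul]
    ring
  · simp

/-- Left multiplication by the element `∑ eⁱ aᵢ` of the cyclic algebra. -/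
noncomputable def cycOp (n m : ℕ) (σ τ : K ≃+* K) (c : K) (a : Fin n → K) :
    Module.End K (Fin n → Fin m → K) :=
  ∑ i : Fin n, eOp n m c ^ (i : ℕ) * scalarOp n m σ τ (a i)

theorem cycOp_apply (c : K) (a : Fin n → K) (v : Fin n → Fin m → K)
    (s : Fin m) : (fun r => cycOp n m σ τ c a v r s) =
      cycMul n σ c (fun i => (τ ^ (s : ℕ)) (a i)) (fun i => v i s) := by
  funext r
  simp only [cycOp, cycMul, LinearMap.sum_apply, Finset.sum_apply, Module.End.mul_apply,
    eOp_pow_apply, scalarOp_apply]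
  refine Finset.sum_congr rfl fun i _ => Finset.sum_congr rfl fun k _ => ?_
  rw [add_comm (k : ℕ)]
  simp only [mul_assoc]

theorem cycOp_delta0 (hn : 0 < n) (c a : K) :
    cycOp n m σ τ c (delta0 n a) = scalarOp n m σ τ a := by
  rw [cycOp, Finset.sum_eq_single (⟨0, hn⟩ : Fin n)]
  · simp [delta0]
  · intro b _ hb
    have : (b : ℕ) ≠ 0 := fun h => hb (Fin.ext h)
    simp [delta0, this]
  · simp

theorem cycOp_cycMul (hσ : orderOf σ = n) (hcomm : σ * τ = τ * σ) {c : K} (hcσ : σ c = c)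
    (hcτ : τ c = c) (a b : Fin n → K) :
    cycOp n m σ τ c (cycMul n σ c a b) = cycOp n m σ τ c a * cycOp n m σ τ c b := by
  have hc (q : ℕ) : scalarOp n m σ τ (c ^ q) = eOp n m c ^ (n * q) := by
    rw [map_pow, pow_mul, eOp_pow_self hcσ hcτ]
  simp only [cycOp, cycMul, map_sum, Finset.sum_mul_sum]
  simp only [Finset.mul_sum]
  rw [Finset.sum_comm]
  refine Finset.sum_congr rfl fun i _ => ?_
  rw [Finset.sum_comm]
  refine Finset.sum_congr rfl fun k _ => ?_
  have hn : 0 < n := i.pos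
  rw [Finset.sum_eq_single (⟨((i : ℕ) + k) % n, Nat.mod_lt _ hn⟩ : Fin n)]
  · rw [if_pos rfl, mul_assoc, map_mul, hc, ← mul_assoc, ← pow_add, Nat.mod_add_div, map_mul,
      pow_add]
    simp only [mul_assoc]
    rw [← mul_assoc (scalarOp n m σ τ (a i)), scalarOp_mul_eOp_pow hσ hcomm, mul_assoc]
  · intro r _ hr
    rw [if_neg fun h => hr (Fin.ext h.symm), map_zero, mul_zero]
  · simp

theorem cycOp_mul_fOp_pow (hτ : orderOf τ = m) (c d : K) (a : Fin n → K) (k : ℕ) :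
    cycOp n m σ τ c a * fOp n m d ^ k =
      fOp n m d ^ k * cycOp n m σ τ c (fun i => (τ ^ k) (a i)) := by
  rw [cycOp, cycOp, Finset.sum_mul, Finset.mul_sum]
  refine Finset.sum_congr rfl fun i _ => ?_
  rw [mul_assoc, scalarOp_mul_fOp_pow hτ, ← mul_assoc, ← mul_assoc,
    ((commute_eOp_fOp c d).pow_pow i k).eq]

theorem tenMul_eq_sum (c d : K) (x y : Fin n → Fin m → K) :
    tenMul n m σ τ c d x y =
      ∑ j : Fin m, (fOp n m d ^ (j : ℕ)) (cycOp n m σ τ c (fun i => x i j) y) := by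
  funext r s
  have h (j l : Fin m) : cycOp n m σ τ c (fun i => x i j) y r l =
      cycMul n σ c (fun i => (τ ^ (l : ℕ)) (x i j)) (fun i => y i l) r :=
    congrFun (cycOp_apply c _ y l) r
  simp only [Finset.sum_apply, fOp_pow_apply, wrapShift_pow_apply, h, tenMul, cycMul]
  rw [Finset.sum_comm]
  refine Finset.sum_congr rfl fun j _ => ?_
  simp only [Finset.sum_comm (s := (Finset.univ : Finset (Fin n)))
    (t := (Finset.univ : Finset (Fin m)))]
  refine Finset.sum_congr rfl fun l _ => ?_
  rw [add_comm (l : ℕ)]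
  split_ifs with hs
  · simp only [hs, and_true, Finset.smul_sum]
    refine Finset.sum_congr rfl fun i _ => Finset.sum_congr rfl fun k _ => ?_
    split_ifs
    · rw [smul_eq_mul]; ring
    · simp
  · simp [hs]

theorem exists_cycMul_eq (hσ : orderOf σ = n) {c : K}
    (hD : ∀ x y : Fin n → K, x ≠ 0 → y ≠ 0 → cycMul n σ c x y ≠ 0) {b : Fin n → K} (hb : b ≠ 0)
    (w : Fin n → K) : ∃ a, cycMul n σ c a b = w := by
  let f : (Fin n → K) →+ (Fin n → K) :=
    { toFun := fun a => cycMul n σ c a b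
      map_zero' := by funext r; simp [cycMul]
      map_add' := fun a a' => by
        funext r
        simp only [cycMul, Pi.add_apply, ← Finset.sum_add_distrib]
        refine Finset.sum_congr rfl fun i _ => Finset.sum_congr rfl fun k _ => ?_
        split_ifs
        · rw [map_add]; ring
        · simp }
  refine (injective_iff_surjective_of_twisted (AddEquiv.refl _) (fun i : Fin n => σ ^ (i : ℕ))
    f ?_).mp ?_ w
  · intro a v v' h r
    simp only [AddEquiv.refl_apply] at h ⊢
    change cycMul n σ c v' b r = _ * cycMul n σ c v b r
    simp only [cycMul, Finset.mul_sum]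
    refine Finset.sum_congr rfl fun i _ => Finset.sum_congr rfl fun k _ => ?_
    split_ifs with hr
    · rw [h, pow_apply_eq_of_mod_eq hσ hr, add_comm, pow_add, RingAut.mul_apply, map_mul,
        add_comm]
      ring
    · simp
  · refine (injective_iff_map_eq_zero f).mpr fun a ha => ?_
    by_contra h
    exact hD a b h hb ha

/-- The element of `Fin n → Fin m → K` whose `s`-th column is `w` and whose other columns vanish. -/
noncomputable def column (s : Fin m) (w : Fin n → K) : Fin n → Fin m → K :=
  fun i => Pi.single s (w i)

theorem fOp_pow_column (d : K) (s t : Fin m) (k : ℕ) (h : ((s : ℕ) + k) % m = t)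
    (w : Fin n → K) :
    (fOp n m d ^ k) (column s w) = column t (d ^ (((s : ℕ) + k) / m) • w) := by
  funext i r
  rw [fOp_pow_apply, wrapShift_pow_apply, Finset.sum_eq_single s]
  · have h' : (t : ℕ) = r ↔ r = t := by rw [Fin.ext_iff]; exact eq_comm
    simp [column, Pi.single_apply, h, h']
  · intro j _ hj
    simp [column, hj]
  · simp

/-- A nonzero subgroup stable under left multiplication by the cyclic algebra and by `f` is
everything: the conjugates of `d` being distinct, `fᵐ` separates the columns. -/
theorem eq_top_of_stable (hm : m.Prime) (hσ : orderOf σ = n) (hτ : orderOf τ = m)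
    (hcomm : σ * τ = τ * σ) {c d : K}
    (hd0 : d ≠ 0) (hdσ : σ d = d) (hdτ : τ d ≠ d)
    (hD : ∀ x y : Fin n → K, x ≠ 0 → y ≠ 0 → cycMul n σ c x y ≠ 0)
    (U : AddSubgroup (Fin n → Fin m → K)) (hU : U ≠ ⊥)
    (hcyc : ∀ a, ∀ u ∈ U, cycOp n m σ τ c a u ∈ U) (hf : ∀ u ∈ U, fOp n m d u ∈ U) : U = ⊤ := by
  classical
  have hfpow (k : ℕ) : ∀ u ∈ U, (fOp n m d ^ k) u ∈ U := by
    induction k with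
    | zero => exact fun u hu => hu
    | succ k ih => exact fun u hu => by rw [pow_succ]; exact ih _ (hf u hu)
  have hfix (i s : ℕ) : (σ ^ i) ((τ ^ s) d) = (τ ^ s) d := by
    rw [pow_apply_pow_comm hcomm, pow_apply_fixed hdσ]
  have hn : 0 < n := by
    rcases Nat.eq_zero_or_pos n with rfl | h
    · exact absurd (Subsingleton.elim _ _) hU
    · exact h
  -- an element of minimal support is concentrated in one column
  have hcol : ∃ s : Fin m, ∃ w : Fin n → K, w ≠ 0 ∧ column s w ∈ U := by
    let supp (u : Fin n → Fin m → K) : Finset (Fin m) :=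
      Finset.univ.filter fun s => ∃ i, u i s ≠ 0
    have key (N : ℕ) : ∀ u ∈ U, u ≠ 0 → (supp u).card = N →
        ∃ s : Fin m, ∃ w : Fin n → K, w ≠ 0 ∧ column s w ∈ U := by
      induction N using Nat.strong_induction_on with
      | _ N ih =>
        intro u hu hu0 hN
        obtain ⟨i₀, hi₀⟩ := Function.ne_iff.mp hu0
        obtain ⟨s, hs⟩ := Function.ne_iff.mp hi₀
        by_cases hone : ∀ t, t ≠ s → ∀ i, u i t = 0
        · refine ⟨s, fun i => u i s, fun h => hs (congrFun h i₀), ?_⟩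
          convert hu using 1
          funext i t
          by_cases hts : t = s
          · subst hts; simp [column]
          · simp [column, hts, hone t hts]
        · push Not at hone
          obtain ⟨t, hts, i, hit⟩ := hone
          let a : K := (τ ^ (m - (s : ℕ))) d
          let u' := (fOp n m d ^ m) u - scalarOp n m σ τ a u
          have hu' (j : Fin n) (r : Fin m) :
              u' j r = (d - (τ ^ ((r : ℕ) + (m - (s : ℕ)))) d) * u j r := by
            change (fOp n m d ^ m) u j r - scalarOp n m σ τ a u j r = _
            rw [fOp_pow_self_apply, scalarOp_apply, sub_mul]
            congr 2
            rw [← hfix j, pow_add, RingAut.mul_apply]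
          have hs' : (τ ^ ((s : ℕ) + (m - (s : ℕ)))) d = d := by
            rw [Nat.add_sub_cancel' s.2.le, ← hτ, pow_orderOf_eq_one]; rfl
          have ht' : (τ ^ ((t : ℕ) + (m - (s : ℕ)))) d ≠ d := by
            refine prime_pow_apply_ne hm hτ hdτ fun ⟨q, hq⟩ => hts (Fin.ext ?_)
            have h1 := s.2
            have h2 := t.2
            have h3 : 0 < q := Nat.pos_of_ne_zero fun h => by subst h; omega
            have h4 : q < 2 := by
              by_contra h
              have : m * 2 ≤ m * q := Nat.mul_le_mul_left m (by omega)
              omega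
            obtain rfl : q = 1 := by omega
            omega
          refine ih _ ?_ u' (U.sub_mem (hfpow m u hu) ?_) ?_ rfl
          · rw [← hN]
            refine Finset.card_lt_card (Finset.ssubset_iff_subset_ne.mpr ⟨fun r hr => ?_, ?_⟩)
            · simp only [supp, Finset.mem_filter, Finset.mem_univ, true_and] at hr ⊢
              obtain ⟨j, hj⟩ := hr
              exact ⟨j, fun h => hj (by rw [hu', h, mul_zero])⟩
            · intro h
              have h1 : s ∈ supp u := by simpa [supp] using ⟨i₀, hs⟩
              rw [← h] at h1
              obtain ⟨j, hj⟩ := (Finset.mem_filter.mp h1).2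
              exact hj (by rw [hu', hs', sub_self, zero_mul])
          · rw [← cycOp_delta0 hn c a]
            exact hcyc _ u hu
          · intro h
            have := congrFun (congrFun h i) t
            rw [hu'] at this
            exact mul_ne_zero (sub_ne_zero.mpr ht'.symm) hit this
    obtain ⟨u, hu, hu0⟩ := U.bot_or_exists_ne_zero.resolve_left hU
    exact key _ u hu hu0 rfl
  obtain ⟨s, w, hw, hsw⟩ := hcol
  have hall (w' : Fin n → K) : column s w' ∈ U := by
    obtain ⟨a, ha⟩ := exists_cycMul_eq hσ hD hw w'
    convert hcyc (fun i => (τ ^ (s : ℕ)).symm (a i)) _ hsw using 1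
    funext i t
    refine Eq.trans ?_ (congrFun (cycOp_apply c _ _ t) i).symm
    by_cases hts : t = s
    · subst hts
      simp [column, ha]
    · simp [column, hts, cycMul]
  have hall' (t : Fin m) (w' : Fin n → K) : column t w' ∈ U := by
    have hmod : ((s : ℕ) + (m - s + t)) % m = t := by
      have h1 := s.2
      rw [show (s : ℕ) + (m - s + t) = t + m by omega, Nat.add_mod_right, Nat.mod_eq_of_lt t.2]
    have := hfpow (m - s + t) _ (hall ((d ^ (((s : ℕ) + (m - s + t)) / m))⁻¹ • w'))
    rwa [fOp_pow_column d s t _ hmod, smul_smul, mul_inv_cancel₀ (pow_ne_zero _ hd0), one_smul]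
      at this
  refine (AddSubgroup.eq_top_iff' U).mpr fun v => ?_
  have hv : v = ∑ t : Fin m, column t fun i => v i t := by
    funext i t
    simp [column, Finset.sum_apply, Pi.single_apply]
  rw [hv]
  exact U.sum_mem fun t _ => hall' t _

theorem tenMul_add_left (c d : K) (x x' y : Fin n → Fin m → K) :
    tenMul n m σ τ c d (x + x') y = tenMul n m σ τ c d x y + tenMul n m σ τ c d x' y := by
  funext r s
  simp only [tenMul, Pi.add_apply, ← Finset.sum_add_distrib]
  refine Finset.sum_congr rfl fun i _ => Finset.sum_congr rfl fun j _ =>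
    Finset.sum_congr rfl fun k _ => Finset.sum_congr rfl fun l _ => ?_
  split_ifs
  · rw [map_add, map_add]; ring
  · simp

theorem tenMul_twisted_left (hσ : orderOf σ = n) (hτ : orderOf τ = m) (hcomm : σ * τ = τ * σ)
    (c d a : K) (x x' y : Fin n → Fin m → K)
    (h : ∀ i j, x' i j = (σ ^ (i : ℕ)) ((τ ^ (j : ℕ)) a) * x i j) (r : Fin n) (s : Fin m) :
    tenMul n m σ τ c d x' y r s =
      (σ ^ (r : ℕ)) ((τ ^ (s : ℕ)) a) * tenMul n m σ τ c d x y r s := by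
  simp only [tenMul, Finset.mul_sum]
  refine Finset.sum_congr rfl fun i _ => Finset.sum_congr rfl fun j _ =>
    Finset.sum_congr rfl fun k _ => Finset.sum_congr rfl fun l _ => ?_
  split_ifs with hrs
  · rw [h, pow_apply_eq_of_mod_eq hσ hrs.1, pow_apply_eq_of_mod_eq hτ hrs.2, map_mul, map_mul,
      add_comm (i : ℕ), add_comm (j : ℕ), pow_add, pow_add, RingAut.mul_apply, RingAut.mul_apply,
      pow_apply_pow_comm hcomm i l]
    ring
  · simp

theorem tenMul_ne_zero (hm : m.Prime) (hσ : orderOf σ = n) (hτ : orderOf τ = m)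
    (hcomm : σ * τ = τ * σ) {c d : K} (hcσ : σ c = c) (hcτ : τ c = c)
    (hd0 : d ≠ 0) (hdσ : σ d = d) (hdτ : τ d ≠ d)
    (hD : ∀ x y : Fin n → K, x ≠ 0 → y ≠ 0 → cycMul n σ c x y ≠ 0)
    {x y : Fin n → Fin m → K} (hx : x ≠ 0) (hy : y ≠ 0) : tenMul n m σ τ c d x y ≠ 0 := by
  classical
  intro hxy
  have hn : 0 < n := by
    rcases Nat.eq_zero_or_pos n with rfl | h
    · exact absurd (Subsingleton.elim _ _) hx
    · exact h
  let ρ : (Fin n → Fin m → K) →+ (Fin n → Fin m → K) :=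
    AddMonoidHom.mk' (fun x => tenMul n m σ τ c d x y) fun x x' => tenMul_add_left c d x x' y
  have hρ : ¬ Function.Injective ρ := fun h => hx ((injective_iff_map_eq_zero ρ).mp h x hxy)
  -- the degree of `x` in `f`
  obtain ⟨r, hr, hmax⟩ : ∃ r : Fin m, (fun i => x i r) ≠ 0 ∧
      ∀ j : Fin m, r < j → (fun i => x i j) = 0 := by
    obtain ⟨i₀, hi₀⟩ := Function.ne_iff.mp hx
    obtain ⟨s, hs⟩ := Function.ne_iff.mp hi₀
    let S : Finset (Fin m) := Finset.univ.filter fun j => (fun i => x i j) ≠ 0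
    have hS : S.Nonempty := ⟨s, by simpa [S] using fun h => hs (congrFun h i₀)⟩
    refine ⟨S.max' hS, (Finset.mem_filter.mp (S.max'_mem hS)).2, fun j hj => ?_⟩
    by_contra h
    exact absurd (S.le_max' j (by simpa [S] using h)) (not_le.mpr hj)
  let φ := cycOp n m σ τ c
  let T := fOp n m d
  let U : AddSubgroup (Fin n → Fin m → K) :=
    AddSubgroup.closure {v | ∃ j < (r : ℕ), ∃ a, v = (T ^ j) (φ a y)}
  have hgen (j : ℕ) (hj : j < r) (a : Fin n → K) : (T ^ j) (φ a y) ∈ U :=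
    AddSubgroup.subset_closure ⟨j, hj, a, rfl⟩
  have hstable (g : Module.End K (Fin n → Fin m → K))
      (hg : ∀ j < (r : ℕ), ∀ a, g ((T ^ j) (φ a y)) ∈ U) : ∀ u ∈ U, g u ∈ U := by
    have : U ≤ U.comap g.toAddMonoidHom := by
      refine (AddSubgroup.closure_le _).mpr ?_
      rintro _ ⟨j, hj, a, rfl⟩
      exact hg j hj a
    exact this
  have hswap (b : Fin n → K) (j : ℕ) (v : Fin n → Fin m → K) :
      φ b ((T ^ j) v) = (T ^ j) (φ (fun i => (τ ^ j) (b i)) v) :=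
    LinearMap.congr_fun (cycOp_mul_fOp_pow hτ c d b j) v
  have hmul (a b : Fin n → K) (v : Fin n → Fin m → K) : φ a (φ b v) = φ (cycMul n σ c a b) v :=
    (LinearMap.congr_fun (cycOp_cycMul hσ hcomm hcσ hcτ a b) v).symm
  have hone (v : Fin n → Fin m → K) : φ (delta0 n 1) v = v := by
    simp only [φ, cycOp_delta0 hn, map_one, Module.End.one_apply]
  have hφ (b : Fin n → K) : ∀ u ∈ U, φ b u ∈ U :=
    hstable _ fun j hj a => by rw [hswap, hmul]; exact hgen j hj _
  have hlead : (T ^ (r : ℕ)) (φ (fun i => x i r) y) ∈ U := by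
    rw [tenMul_eq_sum, ← Finset.add_sum_erase _ _ (Finset.mem_univ r)] at hxy
    rw [show (T ^ (r : ℕ)) (φ (fun i => x i r) y) = _ from eq_neg_of_add_eq_zero_left hxy]
    refine U.neg_mem (U.sum_mem fun j hj => ?_)
    rcases lt_or_gt_of_ne (Finset.ne_of_mem_erase hj) with h | h
    · exact hgen j h _
    · have h0 : cycOp n m σ τ c 0 = 0 := by simp [cycOp]
      rw [hmax j h, h0, LinearMap.zero_apply, map_zero]
      exact U.zero_mem
  have htop (a : Fin n → K) : (T ^ (r : ℕ)) (φ a y) ∈ U := by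
    obtain ⟨b, hb⟩ := exists_cycMul_eq hσ hD hr a
    have := hφ (fun i => (τ ^ (r : ℕ)).symm (b i)) _ hlead
    rw [hswap, hmul] at this
    simpa [hb] using this
  have hT : ∀ u ∈ U, T u ∈ U := by
    refine hstable _ fun j hj a => ?_
    rw [← Module.End.mul_apply, ← pow_succ']
    rcases Nat.lt_or_eq_of_le (Nat.succ_le_of_lt hj) with h | h
    · exact hgen _ h a
    · rw [show j + 1 = (r : ℕ) from h]; exact htop a
  have hyU : y ∈ U := by
    rcases Nat.eq_zero_or_pos (r : ℕ) with h | h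
    · have := htop (delta0 n 1)
      rwa [h, hone] at this
    · have := hgen 0 h (delta0 n 1)
      rwa [hone] at this
  have hU : U = ⊤ := eq_top_of_stable hm hσ hτ hcomm hd0 hdσ hdτ hD U
    (fun h => hy (by rwa [h, AddSubgroup.mem_bot] at hyU)) hφ hT
  have hrange : U ≤ ρ.range := by
    refine (AddSubgroup.closure_le _).mpr ?_
    rintro _ ⟨j, hj, a, rfl⟩
    refine ⟨column ⟨j, hj.trans r.2⟩ a, ?_⟩
    change tenMul n m σ τ c d _ y = _
    rw [tenMul_eq_sum, Finset.sum_eq_single (⟨j, hj.trans r.2⟩ : Fin m)]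
    · simp [column, T, φ]
    · intro k _ hk
      simp [column, hk, cycOp]
    · simp
  have hsurj : Function.Surjective ρ :=
    AddMonoidHom.range_eq_top.mp (top_le_iff.mp (hU ▸ hrange))
  refine hρ ((injective_iff_surjective_of_twisted
    (LinearEquiv.curry K K (Fin n) (Fin m)).symm.toAddEquiv
    (fun p => σ ^ (p.1 : ℕ) * τ ^ (p.2 : ℕ)) ρ fun a v w h p => ?_).mpr hsurj)
  exact tenMul_twisted_left hσ hτ hcomm c d a v w y (fun i j => h (i, j)) p.1 p.2

end Operators

/-- Suppose `d ∈ F ∖ F₀`, `D = (K/F,σ,c)` is a division algebra, `m` is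
prime, and, in case `m ≠ 2, 3`, `F₀` contains a primitive `m`-th root of unity. If
`τ(dⁿ) ≠ dⁿ`, then `A = (L/F₀,σ,c) ⊗_{F₀} (F/F₀,τ,d)` is a division algebra. -/
theorem tensor_division_of_tau_ne {K : Type*} [Field K] (n m : ℕ)
    (hn : 0 < n) (hmp : m.Prime)
    (σ τ : K ≃+* K) (hσord : orderOf σ = n) (hτord : orderOf τ = m)
    (hcomm : σ * τ = τ * σ)
    (hindep : ∀ i j : ℕ, i < n → j < m → σ ^ i * τ ^ j = 1 → i = 0 ∧ j = 0)
    (hroot : m ≠ 2 → m ≠ 3 → ∃ ζ : K, σ ζ = ζ ∧ τ ζ = ζ ∧ ζ ^ m = 1 ∧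
      ∀ k : ℕ, 0 < k → k < m → ζ ^ k ≠ 1)
    (c : K) (hc0 : c ≠ 0) (hcσ : σ c = c) (hcτ : τ c = c)
    (d : K) (hd0 : d ≠ 0) (hdσ : σ d = d) (hdτ : τ d ≠ d)
    (hD : ∀ x y : Fin n → K, x ≠ 0 → y ≠ 0 → cycMul n σ c x y ≠ 0)
    (hdn : τ (d ^ n) ≠ d ^ n) :
    ∀ x y : Fin n → Fin m → K, x ≠ 0 → y ≠ 0 → tenMul n m σ τ c d x y ≠ 0 := by
  exact fun x y hx hy => tenMul_ne_zero hmp hσord hτord hcomm hcσ hcτ hd0 hdσ hdτ hD hx hy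
end

section
/- Let F₀ be a field of characteristic not 2, let a, b ∈ F₀^× with b not a square in F₀, let L = F₀(√a), F = F₀(√b), and let c ∈ F₀^×. Assume a is not a square in F and the quaternion algebra (a,c)_F = (K/F,σ,c) is a division algebra. Then for every d ∈ F ∖ F₀, the tensor product algebra (a,c)_{F₀} ⊗_{F₀} (F₀(√b)/F₀,τ,d) is a division algebra over F₀. -/
section CyclicQuaternion

variable {K : Type*} [Field K] {σ τ : K ≃+* K} {c : K}

theorem cycMul_two_zero (x y : Fin 2 → K) :
    cycMul 2 σ c x y 0 = x 0 * y 0 + c * σ (x 1) * y 1 := by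
  simp [cycMul, Fin.sum_univ_two]

theorem cycMul_two_one (x y : Fin 2 → K) :
    cycMul 2 σ c x y 1 = σ (x 0) * y 1 + x 1 * y 0 := by
  simp [cycMul, Fin.sum_univ_two]

theorem cycMul_two_assoc (hσ : ∀ t, σ (σ t) = t) (hc : σ c = c) (x y z : Fin 2 → K) :
    cycMul 2 σ c (cycMul 2 σ c x y) z = cycMul 2 σ c x (cycMul 2 σ c y z) := by
  ext r
  fin_cases r <;> simp [cycMul_two_zero, cycMul_two_one, hσ, hc] <;> ring

theorem cycMul_two_smul_left {s : K} (hs : σ s = s) (x y : Fin 2 → K) :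
    cycMul 2 σ c (s • x) y = s • cycMul 2 σ c x y := by
  ext r
  fin_cases r <;> simp [cycMul_two_zero, cycMul_two_one, hs] <;> ring

theorem cycMul_two_smul_right (s : K) (x y : Fin 2 → K) :
    cycMul 2 σ c x (s • y) = s • cycMul 2 σ c x y := by
  ext r
  fin_cases r <;> simp [cycMul_two_zero, cycMul_two_one] <;> ring

theorem cycMul_two_sub_right (x y z : Fin 2 → K) :
    cycMul 2 σ c x (y - z) = cycMul 2 σ c x y - cycMul 2 σ c x z := by
  ext r
  fin_cases r <;> simp [cycMul_two_zero, cycMul_two_one] <;> ring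

theorem cycMul_two_add_left (x y z : Fin 2 → K) :
    cycMul 2 σ c (x + y) z = cycMul 2 σ c x z + cycMul 2 σ c y z := by
  ext r
  fin_cases r <;> simp [cycMul_two_zero, cycMul_two_one] <;> ring

theorem cycMul_two_zero_left (y : Fin 2 → K) : cycMul 2 σ c 0 y = 0 := by
  ext r
  fin_cases r <;> simp [cycMul_two_zero, cycMul_two_one]

theorem cycMul_two_zero_right (x : Fin 2 → K) : cycMul 2 σ c x 0 = 0 := by
  ext r
  fin_cases r <;> simp [cycMul_two_zero, cycMul_two_one]

theorem cycMul_two_delta0_left {s : K} (hs : σ s = s) (y : Fin 2 → K) :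
    cycMul 2 σ c (delta0 2 s) y = s • y := by
  ext r
  fin_cases r <;> simp [cycMul_two_zero, cycMul_two_one, delta0, hs]

theorem cycMul_two_delta0_right (x : Fin 2 → K) {s : K} :
    cycMul 2 σ c x (delta0 2 s) = s • x := by
  ext r
  fin_cases r <;> simp [cycMul_two_zero, cycMul_two_one, delta0] <;> ring

theorem map_cycMul_two (hcomm : ∀ t, τ (σ t) = σ (τ t)) (hc : τ c = c) (x y : Fin 2 → K) :
    τ ∘ cycMul 2 σ c x y = cycMul 2 σ c (τ ∘ x) (τ ∘ y) := by
  ext r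
  fin_cases r <;> simp [cycMul_two_zero, cycMul_two_one, hcomm, hc]

/-- A nonzero element of a division algebra `(K/F,σ,c)` of degree two has a right inverse. -/
theorem exists_cycMul_two_eq_one
    (hD : ∀ x y : Fin 2 → K, x ≠ 0 → y ≠ 0 → cycMul 2 σ c x y ≠ 0)
    {x : Fin 2 → K} (hx : x ≠ 0) : ∃ y, cycMul 2 σ c x y = delta0 2 1 := by
  set N := x 0 * σ (x 0) - c * σ (x 1) * x 1 with hN
  have hconj : cycMul 2 σ c x ![σ (x 0), -x 1] = delta0 2 N := by
    ext r
    fin_cases r <;> simp [cycMul_two_zero, cycMul_two_one, delta0, hN] <;> ring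
  have hN0 : N ≠ 0 := by
    intro h
    refine hD x ![σ (x 0), -x 1] hx (fun h0 => hx ?_) ?_
    · have h1 : x 0 = 0 := by simpa using congrFun h0 0
      have h2 : x 1 = 0 := by simpa using congrFun h0 1
      ext r
      fin_cases r
      exacts [h1, h2]
    · rw [hconj, h]
      ext r
      simp [delta0]
  refine ⟨N⁻¹ • ![σ (x 0), -x 1], ?_⟩
  rw [cycMul_two_smul_right, hconj]
  ext r
  fin_cases r <;> simp [delta0, hN0]

/-- No `d` moved by `τ` is of the form `w · τ̃(w)` in the division algebra `(K/F,σ,c)`. -/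
theorem cycMul_two_map_ne_delta0 (hσ : ∀ t, σ (σ t) = t) (hτ : ∀ t, τ (τ t) = t)
    (hcomm : ∀ t, τ (σ t) = σ (τ t)) (hcσ : σ c = c) (hcτ : τ c = c)
    {d : K} (hd0 : d ≠ 0) (hd : σ d = d) (hdτ : τ d ≠ d) (w : Fin 2 → K) :
    cycMul 2 σ c w (τ ∘ w) ≠ delta0 2 d := by
  intro h
  have hττ : τ ∘ τ ∘ w = w := by ext; simp [hτ]
  have hτd : τ ∘ delta0 2 d = delta0 2 (τ d) := by
    ext r
    fin_cases r <;> simp [delta0]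
  have h' : cycMul 2 σ c (τ ∘ w) w = delta0 2 (τ d) := by
    rw [← hτd, ← h, map_cycMul_two hcomm hcτ, hττ]
  have key : d • w = τ d • w := by
    rw [← cycMul_two_delta0_left hd, ← h, cycMul_two_assoc hσ hcσ, h', cycMul_two_delta0_right]
  have hw : w = 0 := by
    have : (d - τ d) • w = 0 := by rw [sub_smul, key, sub_self]
    exact (smul_eq_zero.mp this).resolve_left (sub_ne_zero.mpr hdτ.symm)
  apply hd0
  simpa [hw, cycMul_two_zero_left, delta0] using (congrFun h 0).symm

end CyclicQuaternion

section Tensor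

variable {K : Type*} [Field K] {σ τ : K ≃+* K} {c d : K}

theorem tenMul_two_zero (x y : Fin 2 → Fin 2 → K) :
    (fun r => tenMul 2 2 σ τ c d x y r 0) =
      cycMul 2 σ c (x · 0) (y · 0) + d • cycMul 2 σ c (τ ∘ (x · 1)) (y · 1) := by
  ext r
  fin_cases r <;>
    simp [tenMul, cycMul_two_zero, cycMul_two_one, Fin.sum_univ_two] <;> ring

theorem tenMul_two_one (x y : Fin 2 → Fin 2 → K) :
    (fun r => tenMul 2 2 σ τ c d x y r 1) =
      cycMul 2 σ c (τ ∘ (x · 0)) (y · 1) + cycMul 2 σ c (x · 1) (y · 0) := by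
  ext r
  fin_cases r <;>
    simp [tenMul, cycMul_two_zero, cycMul_two_one, Fin.sum_univ_two] <;> ring

end Tensor

/-- Let `F₀` be a field of characteristic not 2, `a, b ∈ F₀^×` with `b` not
a square in `F₀`, `L = F₀(√a)`, `F = F₀(√b)`, `c ∈ F₀^×`. Assume `a` is not a square in `F`
and the quaternion algebra `(a,c)_F = (K/F,σ,c)` is a division algebra. Then for every
`d ∈ F ∖ F₀`, the tensor product `(a,c)_{F₀} ⊗_{F₀} (F₀(√b)/F₀,τ,d)` is a division algebra
over `F₀`.

Here `K = F₀(√a,√b)` is encoded as a field with commuting automorphisms `σ, τ` of order 2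
generating a group of order 4; `F₀` is the common fixed field; `α = √a` satisfies
`σ(α) = −α`, `τ(α) = α` and `β = √b` satisfies `σ(β) = β`, `τ(β) = −β` (in particular `a` is
not a square in `F = Fix σ` and `b` is not a square in `F₀`, since `char ≠ 2`). -/
theorem biquaternion_division {K : Type*} [Field K] (hchar : (2 : K) ≠ 0)
    (σ τ : K ≃+* K) (hσord : orderOf σ = 2) (hτord : orderOf τ = 2)
    (hcomm : σ * τ = τ * σ)
    (hindep : ∀ i j : ℕ, i < 2 → j < 2 → σ ^ i * τ ^ j = 1 → i = 0 ∧ j = 0)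
    (a : K) (ha0 : a ≠ 0) (haσ : σ a = a) (haτ : τ a = a)
    (α : K) (hα : α ^ 2 = a) (hασ : σ α = -α) (hατ : τ α = α)
    (b : K) (hb0 : b ≠ 0) (hbσ : σ b = b) (hbτ : τ b = b)
    (β : K) (hβ : β ^ 2 = b) (hβσ : σ β = β) (hβτ : τ β = -β)
    (c : K) (hc0 : c ≠ 0) (hcσ : σ c = c) (hcτ : τ c = c)
    (hD : ∀ x y : Fin 2 → K, x ≠ 0 → y ≠ 0 → cycMul 2 σ c x y ≠ 0) :
    ∀ d : K, d ≠ 0 → σ d = d → τ d ≠ d →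
      ∀ x y : Fin 2 → Fin 2 → K, x ≠ 0 → y ≠ 0 → tenMul 2 2 σ τ c d x y ≠ 0 := by
  intro d hd0 hdσ hdτ x y hx hy hxy
  have hσ : ∀ t, σ (σ t) = t := fun t => by
    simpa [sq, hσord] using congrArg (fun g : K ≃+* K => g t) (pow_orderOf_eq_one σ)
  have hτ : ∀ t, τ (τ t) = t := fun t => by
    simpa [sq, hτord] using congrArg (fun g : K ≃+* K => g t) (pow_orderOf_eq_one τ)
  have hστ : ∀ t, τ (σ t) = σ (τ t) := fun t => (DFunLike.congr_fun hcomm t).symm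
  have hD' : ∀ {u v : Fin 2 → K}, cycMul 2 σ c u v = 0 → u = 0 ∨ v = 0 := by
    intro u v h
    by_contra! h'
    exact hD u v h'.1 h'.2 h
  have h0 := tenMul_two_zero (σ := σ) (τ := τ) (c := c) (d := d) x y
  have h1 := tenMul_two_one (σ := σ) (τ := τ) (c := c) (d := d) x y
  rw [hxy] at h0 h1
  replace hx : ¬((x · 0) = 0 ∧ (x · 1) = 0) := fun h => hx <| by
    ext r s
    fin_cases s
    exacts [congrFun h.1 r, congrFun h.2 r]
  replace hy : ¬((y · 0) = 0 ∧ (y · 1) = 0) := fun h => hy <| by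
    ext r s
    fin_cases s
    exacts [congrFun h.1 r, congrFun h.2 r]
  replace h0 := h0.symm.trans (show _ = (0 : Fin 2 → K) from rfl)
  replace h1 := h1.symm.trans (show _ = (0 : Fin 2 → K) from rfl)
  generalize (x · 0) = x₀ at *
  generalize (x · 1) = x₁ at *
  generalize (y · 0) = y₀ at *
  generalize (y · 1) = y₁ at *
  have map_eq_zero : ∀ {u : Fin 2 → K}, τ ∘ u = 0 → u = 0 := fun h => by
    ext r
    simpa using congrFun h r
  have hy₁ : y₁ ≠ 0 := by
    rintro rfl
    simp only [cycMul_two_zero_right, smul_zero, add_zero, zero_add] at h0 h1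
    rcases hD' h0 with h | h
    · rcases hD' h1 with h' | h'
      exacts [hx ⟨h, h'⟩, hy ⟨h', rfl⟩]
    · exact hy ⟨h, rfl⟩
  have hx₀ : x₀ ≠ 0 := by
    rintro rfl
    rw [cycMul_two_zero_left, zero_add] at h0
    have h := (hD' ((smul_eq_zero.mp h0).resolve_left hd0)).resolve_right hy₁
    exact hx ⟨rfl, map_eq_zero h⟩
  obtain ⟨v, hv⟩ := exists_cycMul_two_eq_one hD hy₁
  set w := cycMul 2 σ c y₀ v
  have e0 : cycMul 2 σ c x₀ w + d • (τ ∘ x₁) = 0 := by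
    have := congrArg (cycMul 2 σ c · v) h0
    simpa only [cycMul_two_add_left, cycMul_two_smul_left hdσ, cycMul_two_assoc hσ hcσ, hv,
      cycMul_two_delta0_right, cycMul_two_zero_left, one_smul] using this
  have e1 : τ ∘ x₀ + cycMul 2 σ c x₁ w = 0 := by
    have := congrArg (cycMul 2 σ c · v) h1
    simpa only [cycMul_two_add_left, cycMul_two_assoc hσ hcσ, hv,
      cycMul_two_delta0_right, cycMul_two_zero_left, one_smul] using this
  have e2 : x₀ + cycMul 2 σ c (τ ∘ x₁) (τ ∘ w) = 0 := by
    rw [← map_cycMul_two hστ hcτ]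
    ext r
    simpa [hτ] using congrArg τ (congrFun e1 r)
  have e3 : cycMul 2 σ c x₀ (cycMul 2 σ c w (τ ∘ w) - delta0 2 d) = 0 := by
    have := congrArg (cycMul 2 σ c · (τ ∘ w)) e0
    simp only [cycMul_two_add_left, cycMul_two_smul_left hdσ, cycMul_two_assoc hσ hcσ,
      cycMul_two_zero_left, eq_neg_of_add_eq_zero_right e2, smul_neg] at this
    rw [cycMul_two_sub_right, cycMul_two_delta0_right, sub_eq_add_neg, this]
  exact cycMul_two_map_ne_delta0 hσ hτ hστ hcσ hcτ hd0 hdσ hdτ w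
    (sub_eq_zero.mp ((hD' e3).resolve_left hx₀))
end

section
/- Let F₀ be a field of characteristic not 2, L/F₀ a cyclic Galois extension of degree 3 with Gal(L/F₀) = ⟨σ⟩, b ∈ F₀^× a non-square, F = F₀(√b), c ∈ F₀^×, and suppose D = (K/F,σ,c) is a division algebra. Let d = d₀ + √b·d₁ ∈ F ∖ F₀ with d₀, d₁ ∈ F₀ (so d₁ ≠ 0). If 3d₀² + b d₁² ≠ 0, then the tensor product algebra (L/F₀,σ,c) ⊗_{F₀} (F₀(√b)/F₀,τ,d) is a division algebra over F₀. -/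
/-- The matrix of left multiplication by `x` on the cyclic algebra `(K/F,σ,c)` of degree 3, with
respect to the right `K`-basis `{1, e, e²}`. -/
def leftMulMatrix {K : Type*} [Field K] (σ : K ≃+* K) (c : K) (x : Fin 3 → K) :
    Matrix (Fin 3) (Fin 3) K :=
  !![x 0, c * σ (x 2), c * σ (σ (x 1));
     x 1, σ (x 0), c * σ (σ (x 2));
     x 2, σ (x 1), σ (σ (x 0))]

/-- The reduced norm of the cyclic algebra `(K/F,σ,c)` of degree 3. -/
noncomputable def reducedNorm {K : Type*} [Field K] (σ : K ≃+* K) (c : K) (x : Fin 3 → K) : K :=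
  (leftMulMatrix σ c x).det

lemma cycMul_three {K : Type*} [Field K] (σ : K ≃+* K) (c : K) (x y : Fin 3 → K) :
    cycMul 3 σ c x y =
      ![x 0 * y 0 + c * σ (x 2) * y 1 + c * σ (σ (x 1)) * y 2,
        x 1 * y 0 + σ (x 0) * y 1 + c * σ (σ (x 2)) * y 2,
        x 2 * y 0 + σ (x 1) * y 1 + σ (σ (x 0)) * y 2] := by
  ext r
  fin_cases r <;> simp [cycMul, Fin.sum_univ_three] <;> ring

lemma leftMulMatrix_mulVec {K : Type*} [Field K] (σ : K ≃+* K) (c : K) (x y : Fin 3 → K) :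
    (leftMulMatrix σ c x).mulVec y = cycMul 3 σ c x y := by
  rw [cycMul_three]
  ext r
  fin_cases r <;> simp [leftMulMatrix, Matrix.mulVec, dotProduct, Fin.sum_univ_three]

lemma leftMulMatrix_cycMul {K : Type*} [Field K] {σ : K ≃+* K} {c : K}
    (hσ : ∀ a, σ (σ (σ a)) = a) (hc : σ c = c) (x y : Fin 3 → K) :
    leftMulMatrix σ c (cycMul 3 σ c x y) = leftMulMatrix σ c x * leftMulMatrix σ c y := by
  rw [cycMul_three]
  ext r s
  fin_cases r <;> fin_cases s <;>
    simp [leftMulMatrix, Matrix.mul_apply, Fin.sum_univ_three, hσ, hc] <;> ring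

lemma reducedNorm_cycMul {K : Type*} [Field K] {σ : K ≃+* K} {c : K}
    (hσ : ∀ a, σ (σ (σ a)) = a) (hc : σ c = c) (x y : Fin 3 → K) :
    reducedNorm σ c (cycMul 3 σ c x y) = reducedNorm σ c x * reducedNorm σ c y := by
  simp only [reducedNorm, leftMulMatrix_cycMul hσ hc, Matrix.det_mul]

lemma reducedNorm_smul {K : Type*} [Field K] {σ : K ≃+* K} {a : K} (ha : σ a = a) (c : K)
    (x : Fin 3 → K) : reducedNorm σ c (a • x) = a ^ 3 * reducedNorm σ c x := by
  simp [reducedNorm, leftMulMatrix, Matrix.det_fin_three, ha]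
  ring

lemma reducedNorm_comp {K : Type*} [Field K] {σ τ : K ≃+* K} {c : K}
    (hcomm : ∀ a, σ (τ a) = τ (σ a)) (hc : τ c = c) (x : Fin 3 → K) :
    reducedNorm σ c (fun i => τ (x i)) = τ (reducedNorm σ c x) := by
  simp [reducedNorm, leftMulMatrix, Matrix.det_fin_three, hcomm, hc]

lemma reducedNorm_eq_zero {K : Type*} [Field K] {σ : K ≃+* K} {c : K}
    (hD : ∀ x y : Fin 3 → K, x ≠ 0 → y ≠ 0 → cycMul 3 σ c x y ≠ 0) {x : Fin 3 → K} :
    reducedNorm σ c x = 0 ↔ x = 0 := by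
  constructor
  · intro h
    obtain ⟨v, hv, hxv⟩ := Matrix.exists_mulVec_eq_zero_iff.mpr h
    rw [leftMulMatrix_mulVec] at hxv
    by_contra hx
    exact hD x v hx hv hxv
  · rintro rfl
    simp [reducedNorm, leftMulMatrix, Matrix.det_fin_three]

lemma tenMul_apply_zero {K : Type*} [Field K] (σ τ : K ≃+* K) (c d : K)
    (x y : Fin 3 → Fin 2 → K) :
    (fun i => tenMul 3 2 σ τ c d x y i 0) =
      cycMul 3 σ c (fun i => x i 0) (fun i => y i 0) +
        d • cycMul 3 σ c (fun i => τ (x i 1)) (fun i => y i 1) := by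
  rw [cycMul_three, cycMul_three]
  ext r
  fin_cases r <;> simp [tenMul, Fin.sum_univ_three] <;> ring

lemma tenMul_apply_one {K : Type*} [Field K] (σ τ : K ≃+* K) (c d : K)
    (x y : Fin 3 → Fin 2 → K) :
    (fun i => tenMul 3 2 σ τ c d x y i 1) =
      cycMul 3 σ c (fun i => x i 1) (fun i => y i 0) +
        cycMul 3 σ c (fun i => τ (x i 0)) (fun i => y i 1) := by
  rw [cycMul_three, cycMul_three]
  ext r
  fin_cases r <;> simp [tenMul, Fin.sum_univ_three] <;> ring

/-- Let `F₀` be a field of characteristic not 2, `L/F₀` cyclic Galois of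
degree 3 with `Gal(L/F₀) = ⟨σ⟩`, `b ∈ F₀^×` a non-square, `F = F₀(√b)`, `c ∈ F₀^×`, and
suppose `D = (K/F,σ,c)` is a division algebra. Let `d = d₀ + √b·d₁ ∈ F ∖ F₀` with
`d₀, d₁ ∈ F₀`, `d₁ ≠ 0`. If `3d₀² + b d₁² ≠ 0`, then
`(L/F₀,σ,c) ⊗_{F₀} (F₀(√b)/F₀,τ,d)` is a division algebra over `F₀`. -/
theorem cubic_times_quaternion_division {K : Type*} [Field K] (hchar : (2 : K) ≠ 0)
    (σ τ : K ≃+* K) (hσord : orderOf σ = 3) (hτord : orderOf τ = 2)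
    (hcomm : σ * τ = τ * σ)
    (hindep : ∀ i j : ℕ, i < 3 → j < 2 → σ ^ i * τ ^ j = 1 → i = 0 ∧ j = 0)
    (b : K) (hb0 : b ≠ 0) (hbσ : σ b = b) (hbτ : τ b = b)
    (β : K) (hβ : β ^ 2 = b) (hβσ : σ β = β) (hβτ : τ β = -β)
    (c : K) (hc0 : c ≠ 0) (hcσ : σ c = c) (hcτ : τ c = c)
    (hD : ∀ x y : Fin 3 → K, x ≠ 0 → y ≠ 0 → cycMul 3 σ c x y ≠ 0)
    (d₀ d₁ : K) (hd₀σ : σ d₀ = d₀) (hd₀τ : τ d₀ = d₀)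
    (hd₁σ : σ d₁ = d₁) (hd₁τ : τ d₁ = d₁) (hd₁ : d₁ ≠ 0)
    (hcond : 3 * d₀ ^ 2 + b * d₁ ^ 2 ≠ 0) :
    ∀ x y : Fin 3 → Fin 2 → K, x ≠ 0 → y ≠ 0 →
      tenMul 3 2 σ τ c (d₀ + β * d₁) x y ≠ 0 := by
  intro x y hx hy hxy
  have hσ (a : K) : σ (σ (σ a)) = a := by
    simpa [hσord, pow_succ, RingAut.mul_apply] using DFunLike.congr_fun (pow_orderOf_eq_one σ) a
  have hτ (a : K) : τ (τ a) = a := by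
    simpa [hτord, pow_succ, RingAut.mul_apply] using DFunLike.congr_fun (pow_orderOf_eq_one τ) a
  have hστ (a : K) : σ (τ a) = τ (σ a) := DFunLike.congr_fun hcomm a
  have hN {z : Fin 3 → K} := reducedNorm_eq_zero hD (x := z)
  have eq_zero {z : Fin 3 → Fin 2 → K} (h0 : reducedNorm σ c (fun i => z i 0) = 0)
      (h1 : reducedNorm σ c (fun i => z i 1) = 0) : z = 0 := by
    ext i j
    fin_cases j
    · exact congr_fun (hN.mp h0) i
    · exact congr_fun (hN.mp h1) i
  set d := d₀ + β * d₁ with hd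
  have hdσ : σ d = d := by simp [hd, hd₀σ, hβσ, hd₁σ]
  have e0 := tenMul_apply_zero σ τ c d x y
  have e1 := tenMul_apply_one σ τ c d x y
  rw [hxy] at e0 e1
  replace e0 := congr_arg (reducedNorm σ c) (eq_neg_of_add_eq_zero_left e0.symm)
  replace e1 := congr_arg (reducedNorm σ c) (eq_neg_of_add_eq_zero_left e1.symm)
  have norm_neg (z : Fin 3 → K) : reducedNorm σ c (-z) = -reducedNorm σ c z := by
    have := reducedNorm_smul (σ := σ) (a := -1) (by simp) c z
    rwa [neg_one_smul, Odd.neg_one_pow (by decide), neg_one_mul] at this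
  simp only [norm_neg, reducedNorm_smul hdσ, reducedNorm_cycMul hσ hcσ,
    reducedNorm_comp hστ hcτ] at e0 e1
  have hx' := mt (fun h : _ ∧ _ => eq_zero h.1 h.2) hx
  have hy' := mt (fun h : _ ∧ _ => eq_zero h.1 h.2) hy
  generalize reducedNorm σ c (fun i => x i 0) = p at *
  generalize reducedNorm σ c (fun i => x i 1) = q at *
  generalize reducedNorm σ c (fun i => y i 0) = u at *
  generalize reducedNorm σ c (fun i => y i 1) = v at *
  have hq : q ≠ 0 := by
    rintro rfl
    have hp : p ≠ 0 := fun h => hx' ⟨h, rfl⟩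
    refine hy' ⟨?_, ?_⟩ <;> simp_all
  have hv : v ≠ 0 := by
    rintro rfl
    exact hy' ⟨by simpa [hq] using e1, rfl⟩
  have key : p * τ p = d ^ 3 * (q * τ q) := by
    apply mul_right_cancel₀ hv
    linear_combination p * e1 - q * e0
  have key' := congr_arg τ key
  simp only [map_mul, map_pow, hτ] at key'
  have hqq : q * τ q ≠ 0 := mul_ne_zero hq (by simpa using hq)
  have hdτ : τ d ^ 3 = d ^ 3 := by
    apply mul_right_cancel₀ hqq
    linear_combination key - key'
  have hβ0 : β ≠ 0 := by
    rintro rfl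
    exact hb0 (by simpa using hβ.symm)
  refine mul_ne_zero (mul_ne_zero (mul_ne_zero hchar hβ0) hd₁) hcond ?_
  simp only [hd, map_add, map_mul, hd₀τ, hβτ, hd₁τ] at hdτ
  linear_combination -hdτ - 2 * β * d₁ ^ 3 * hβ
end

section
/- Let F₀ = ℚ, let L/ℚ be a cyclic Galois extension of degree 3 with Gal(L/ℚ) = ⟨σ⟩, let b ∈ ℚ^× be a non-square, F = ℚ(√b), c ∈ ℚ^×, and suppose D = (K/F,σ,c) is a division algebra. If b > 0, or if b < 0 and −b/3 is not a square in ℚ, then for every d ∈ F ∖ ℚ the tensor product algebra (L/ℚ,σ,c) ⊗_ℚ (ℚ(√b)/ℚ,τ,d) is a division algebra over ℚ. -/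
theorem cycMul_three_apply {K : Type*} [Field K] (σ : K ≃+* K) (c : K) (x y : Fin 3 → K) :
    cycMul 3 σ c x y = ![x 0 * y 0 + c * σ (σ (x 1)) * y 2 + c * σ (x 2) * y 1,
      σ (x 0) * y 1 + x 1 * y 0 + c * σ (σ (x 2)) * y 2,
      σ (σ (x 0)) * y 2 + σ (x 1) * y 1 + x 2 * y 0] := by
  ext r
  fin_cases r <;>
  · simp [cycMul, Fin.sum_univ_three]
    try ring

/-- The underlying type of a cyclic algebra of degree three. -/
def CyclicCubic (K : Type*) : Type _ := Fin 3 → K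

namespace CyclicCubic

variable {K : Type*} [Field K]

instance : AddCommGroup (CyclicCubic K) := inferInstanceAs (AddCommGroup (Fin 3 → K))

instance : Module K (CyclicCubic K) := inferInstanceAs (Module K (Fin 3 → K))

instance : FiniteDimensional K (CyclicCubic K) :=
  inferInstanceAs (FiniteDimensional K (Fin 3 → K))

instance : Nontrivial (CyclicCubic K) := inferInstanceAs (Nontrivial (Fin 3 → K))

theorem cycMul_add (σ : K ≃+* K) (c : K) (x y z : Fin 3 → K) :
    cycMul 3 σ c x (y + z) = cycMul 3 σ c x y + cycMul 3 σ c x z := by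
  ext r
  fin_cases r <;> simp [cycMul_three_apply] <;> ring

theorem add_cycMul (σ : K ≃+* K) (c : K) (x y z : Fin 3 → K) :
    cycMul 3 σ c (x + y) z = cycMul 3 σ c x z + cycMul 3 σ c y z := by
  ext r
  fin_cases r <;> simp [cycMul_three_apply] <;> ring

theorem cycMul_smul (σ : K ≃+* K) (c a : K) (x y : Fin 3 → K) :
    cycMul 3 σ c x (a • y) = a • cycMul 3 σ c x y := by
  ext r
  fin_cases r <;> simp [cycMul_three_apply] <;> ring

theorem cycMul_assoc (σ : K ≃+* K) (c : K) (hσ : ∀ a, σ (σ (σ a)) = a) (hc : σ c = c)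
    (x y z : Fin 3 → K) :
    cycMul 3 σ c (cycMul 3 σ c x y) z = cycMul 3 σ c x (cycMul 3 σ c y z) := by
  ext r
  fin_cases r <;> simp [cycMul_three_apply, hσ, hc] <;> ring

theorem cycMul_delta0_left (σ : K ≃+* K) (c a : K) (ha : σ a = a) (x : Fin 3 → K) :
    cycMul 3 σ c (delta0 3 a) x = a • x := by
  ext r
  fin_cases r <;> simp [cycMul_three_apply, delta0, ha]

theorem cycMul_delta0_right (σ : K ≃+* K) (c a : K) (x : Fin 3 → K) :
    cycMul 3 σ c x (delta0 3 a) = a • x := by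
  ext r
  fin_cases r <;> simp [cycMul_three_apply, delta0, mul_comm]

theorem map_cycMul (σ τ : K ≃+* K) (c : K) (hστ : ∀ a, τ (σ a) = σ (τ a)) (hc : τ c = c)
    (x y : Fin 3 → K) :
    τ ∘ cycMul 3 σ c x y = cycMul 3 σ c (τ ∘ x) (τ ∘ y) := by
  ext r
  fin_cases r <;> simp [cycMul_three_apply, hστ, hc]

/-- The ring structure of the cyclic algebra `(K/F,σ,c)` of degree three. -/
@[reducible]
noncomputable def ring (σ : K ≃+* K) (c : K) (hσ : ∀ a, σ (σ (σ a)) = a) (hc : σ c = c) :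
    Ring (CyclicCubic K) where
  __ := (inferInstance : AddCommGroup (CyclicCubic K))
  mul := cycMul 3 σ c
  one := delta0 3 1
  left_distrib := cycMul_add σ c
  right_distrib := add_cycMul σ c
  zero_mul x := left_eq_add.mp ((congrArg (cycMul 3 σ c · x) (add_zero 0).symm).trans
    (add_cycMul σ c 0 0 x))
  mul_zero x := left_eq_add.mp ((congrArg (cycMul 3 σ c x) (add_zero 0).symm).trans
    (cycMul_add σ c x 0 0))
  mul_assoc := cycMul_assoc σ c hσ hc
  one_mul x := (cycMul_delta0_left σ c 1 (map_one σ) x).trans (one_smul K x)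
  mul_one x := (cycMul_delta0_right σ c 1 x).trans (one_smul K x)

theorem exists_cycMul_eq (σ : K ≃+* K) (c : K) {x : Fin 3 → K}
    (hx : ∀ y, y ≠ 0 → cycMul 3 σ c x y ≠ 0) (z : Fin 3 → K) :
    ∃ y, cycMul 3 σ c x y = z := by
  let f : (Fin 3 → K) →ₗ[K] (Fin 3 → K) :=
    { toFun := cycMul 3 σ c x
      map_add' := cycMul_add σ c x
      map_smul' := fun a y => cycMul_smul σ c a x y }
  have hf : Function.Injective f := by
    rw [injective_iff_map_eq_zero]
    intro y hy
    by_contra h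
    exact hx y h hy
  exact LinearMap.injective_iff_surjective.mp hf z

end CyclicCubic

theorem tenMul_three_two_eq_zero {K : Type*} [Field K] {σ τ : K ≃+* K} {c d : K}
    {x y : Fin 3 → Fin 2 → K} (h : tenMul 3 2 σ τ c d x y = 0) :
    cycMul 3 σ c (fun i => x i 0) (fun i => y i 0) +
        d • cycMul 3 σ c (τ ∘ fun i => x i 1) (fun i => y i 1) = 0 ∧
      cycMul 3 σ c (τ ∘ fun i => x i 0) (fun i => y i 1) +
        cycMul 3 σ c (fun i => x i 1) (fun i => y i 0) = 0 := by
  have h' (r : Fin 3) (s : Fin 2) : tenMul 3 2 σ τ c d x y r s = 0 := by rw [h]; rfl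
  constructor <;> ext r
  · rw [Pi.zero_apply, ← h' r 0]
    fin_cases r <;>
    · simp [tenMul, cycMul_three_apply, Fin.sum_univ_three, Fin.sum_univ_two]
      ring
  · rw [Pi.zero_apply, ← h' r 1]
    fin_cases r <;>
    · simp [tenMul, cycMul_three_apply, Fin.sum_univ_three, Fin.sum_univ_two]
      ring

/-- A multiplicative involution `T` fixes `T z * z` when `z ≠ 0` commutes with it. -/
theorem map_twisted_square_eq {D : Type*} [Ring D] [NoZeroDivisors D] {T : D → D}
    (hTmul : ∀ x y, T (x * y) = T x * T y) (hTT : ∀ x, T (T x) = x) {z : D}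
    (hz : z ≠ 0) (hcen : Commute (T z * z) z) : T (T z * z) = T z * z := by
  have h : (T (T z * z) - T z * z) * z = 0 := by
    rw [sub_mul, hcen.eq, hTmul, hTT, mul_assoc, sub_self]
  exact sub_eq_zero.mp ((mul_eq_zero.mp h).resolve_right hz)

/-- The zero divisor analysis for `D ⊕ f D`, where `f ^ 2 = d` is central in `D` and
`a f = f T(a)` for an involution `T` of `D` that does not fix `d`. -/
theorem eq_zero_of_twisted_mul_eq_zero {D : Type*} [Ring D] [Nontrivial D] [NoZeroDivisors D]
    (hinv : ∀ x : D, x ≠ 0 → ∃ y, x * y = 1) {T : D → D}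
    (hTadd : ∀ x y, T (x + y) = T x + T y)
    (hTmul : ∀ x y, T (x * y) = T x * T y) (hTT : ∀ x, T (T x) = x) {d : D}
    (hd : ∀ x, Commute d x) (hTd : T d ≠ d) {x₀ x₁ y₀ y₁ : D}
    (h₀ : x₀ * y₀ + d * (T x₁ * y₁) = 0) (h₁ : T x₀ * y₁ + x₁ * y₀ = 0)
    (hy : y₀ ≠ 0 ∨ y₁ ≠ 0) : x₀ = 0 ∧ x₁ = 0 := by
  have hT0 : T 0 = 0 := by simpa using hTadd 0 0
  have hTneg (x : D) : T (-x) = -T x :=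
    eq_neg_of_add_eq_zero_left (by rw [← hTadd, neg_add_cancel, hT0])
  have hTeq {x : D} (hx : T x = 0) : x = 0 := by rw [← hTT x, hx, hT0]
  have hd0 : d ≠ 0 := by
    rintro rfl
    exact hTd hT0
  by_cases hy₀ : y₀ = 0
  · subst hy₀
    have hy₁ : y₁ ≠ 0 := hy.resolve_left (by simp)
    simp only [mul_zero, zero_add, add_zero, mul_eq_zero, hd0, hy₁, or_false, false_or] at h₀ h₁
    exact ⟨hTeq h₁, hTeq h₀⟩
  obtain ⟨v, hv⟩ := hinv y₀ hy₀
  have hv' : v * y₀ = 1 := by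
    have : y₀ * (v * y₀ - 1) = 0 := by rw [mul_sub, ← mul_assoc, hv, one_mul, mul_one, sub_self]
    exact sub_eq_zero.mp ((mul_eq_zero.mp this).resolve_left hy₀)
  obtain ⟨u, hu⟩ : ∃ u, u = y₁ * v := ⟨_, rfl⟩
  have hy₁ : y₁ = u * y₀ := by rw [hu, mul_assoc, hv', mul_one]
  have hx₁ : x₁ = -(T x₀ * u) := by
    have : (T x₀ * u + x₁) * y₀ = 0 := by rw [add_mul, mul_assoc, ← hy₁, h₁]
    exact eq_neg_of_add_eq_zero_right ((mul_eq_zero.mp this).resolve_right hy₀)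
  have hx₀ : x₀ = 0 := by
    by_contra hx₀
    have hkey : d * (T u * u) = 1 := by
      have : x₀ * (1 - d * (T u * u)) * y₀ = 0 := by
        rw [← h₀, hx₁, hTneg, hTmul, hTT, hy₁, mul_sub, ← mul_assoc x₀ d, ← (hd x₀).eq]
        noncomm_ring
      exact (sub_eq_zero.mp ((mul_eq_zero.mp ((mul_eq_zero.mp this).resolve_right
        hy₀)).resolve_left hx₀)).symm
    have hu0 : u ≠ 0 := by
      intro h
      simp [h] at hkey
    have hcen : Commute (T u * u) u := by
      have : d * (T u * u * u - u * (T u * u)) = 0 := by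
        rw [mul_sub, ← mul_assoc, hkey, ← mul_assoc d u, (hd u).eq, mul_assoc u d, hkey, one_mul,
          mul_one, sub_self]
      exact sub_eq_zero.mp ((mul_eq_zero.mp this).resolve_left hd0)
    have hfix := map_twisted_square_eq hTmul hTT hu0 hcen
    have hT1 : T 1 = 1 := by rw [← one_mul (T 1), ← hTT (1 * T 1), hTmul, hTT, mul_one, hTT]
    have hTu : T u * u ≠ 0 := mul_ne_zero (fun h => hu0 (hTeq h)) hu0
    have : (T d - d) * (T u * u) = 0 := by
      rw [sub_mul, hkey, ← hfix, ← hTmul, hkey, hT1, sub_self]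
    exact hTd (sub_eq_zero.mp ((mul_eq_zero.mp this).resolve_right hTu))
  refine ⟨hx₀, ?_⟩
  rw [hx₁, hx₀, hT0, zero_mul, neg_zero]

/-- Let `F₀ = ℚ`, `L/ℚ` cyclic Galois of degree 3 with `Gal(L/ℚ) = ⟨σ⟩`,
`b ∈ ℚ^×` a non-square, `F = ℚ(√b)`, `c ∈ ℚ^×`, and suppose `D = (K/F,σ,c)` is a division
algebra. If `b > 0`, or if `b < 0` and `−b/3` is not a square in `ℚ`, then for every
`d ∈ F ∖ ℚ` the tensor product `(L/ℚ,σ,c) ⊗_ℚ (ℚ(√b)/ℚ,τ,d)` is a division algebra over `ℚ`.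

The compositum `K` is encoded as a field of characteristic 0 whose subfield fixed by both
`σ` and `τ` is exactly `ℚ`; `d ∈ F ∖ ℚ` means `σ d = d` and `τ d ≠ d`. -/
theorem cubic_times_quaternion_division_rat {K : Type*} [Field K] [CharZero K]
    (σ τ : K ≃+* K) (hσord : orderOf σ = 3) (hτord : orderOf τ = 2)
    (hcomm : σ * τ = τ * σ)
    (hindep : ∀ i j : ℕ, i < 3 → j < 2 → σ ^ i * τ ^ j = 1 → i = 0 ∧ j = 0)
    (hfix : ∀ x : K, σ x = x → τ x = x → ∃ q : ℚ, x = (q : K))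
    (b : ℚ) (hb0 : b ≠ 0) (hbns : ¬ ∃ q : ℚ, q ^ 2 = b)
    (β : K) (hβ : β ^ 2 = (b : K)) (hβσ : σ β = β) (hβτ : τ β = -β)
    (c : ℚ) (hc0 : c ≠ 0)
    (hD : ∀ x y : Fin 3 → K, x ≠ 0 → y ≠ 0 → cycMul 3 σ (c : K) x y ≠ 0)
    (hcond : 0 < b ∨ (b < 0 ∧ ¬ ∃ q : ℚ, q ^ 2 = -b / 3)) :
    ∀ d : K, σ d = d → τ d ≠ d →
      ∀ x y : Fin 3 → Fin 2 → K, x ≠ 0 → y ≠ 0 → tenMul 3 2 σ τ (c : K) d x y ≠ 0 := by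
  intro d hσd hτd x y hx hy hxy
  have hστ (a : K) : τ (σ a) = σ (τ a) := (DFunLike.congr_fun hcomm a).symm
  have hσ (a : K) : σ (σ (σ a)) = a := by
    have := DFunLike.congr_fun (hσord ▸ pow_orderOf_eq_one σ) a
    simpa [pow_succ, RingAut.mul_apply] using this
  have hτ (a : K) : τ (τ a) = a := by
    have := DFunLike.congr_fun (hτord ▸ pow_orderOf_eq_one τ) a
    simpa [pow_succ, RingAut.mul_apply] using this
  obtain ⟨h₀, h₁⟩ := tenMul_three_two_eq_zero hxy
  let _ : Ring (CyclicCubic K) := CyclicCubic.ring σ c hσ (map_ratCast σ c)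
  have : NoZeroDivisors (CyclicCubic K) :=
    ⟨fun {x y} h => by
      by_contra! hne
      exact hD x y hne.1 hne.2 h⟩
  have hinv (x : CyclicCubic K) (hx : x ≠ 0) : ∃ y, x * y = 1 :=
    CyclicCubic.exists_cycMul_eq σ c (fun y hy => hD x y hx hy) (delta0 3 1)
  have hTd : (τ ∘ delta0 3 d : Fin 3 → K) ≠ delta0 3 d := fun h =>
    hτd (by simpa [delta0] using congr_fun h 0)
  rw [← CyclicCubic.cycMul_delta0_left σ c d hσd] at h₀
  have hy' : (fun i => y i 0) ≠ 0 ∨ (fun i => y i 1) ≠ 0 := by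
    by_contra! h
    apply hy
    ext i j
    fin_cases j
    · exact congr_fun h.1 i
    · exact congr_fun h.2 i
  obtain ⟨hx₀, hx₁⟩ := eq_zero_of_twisted_mul_eq_zero (D := CyclicCubic K) hinv
    (T := fun x => τ ∘ x) (fun x y => funext fun i => map_add τ (x i) (y i))
    (fun x y => CyclicCubic.map_cycMul σ τ c hστ (map_ratCast τ c) x y)
    (fun x => funext fun i => hτ (x i)) (d := delta0 3 d)
    (fun x => (CyclicCubic.cycMul_delta0_left σ c d hσd x).trans
      (CyclicCubic.cycMul_delta0_right σ c d x).symm) hTd h₀ h₁ hy'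
  apply hx
  ext i j
  fin_cases j
  · exact congr_fun hx₀ i
  · exact congr_fun hx₁ i
end

section
/- Let d ∈ F^×. If τ(dⁿ) ≠ dⁿ, then d ≠ z·τ̃(z)·τ̃²(z)⋯τ̃^{m−1}(z) for all z ∈ D = (K/F,σ,c). -/
/-- The matrix of left multiplication by `x` on the cyclic algebra `(K/F,σ,c)`, with respect to
the right `K`-basis `{1, e, …, e^{n-1}}`. -/
noncomputable def cycMatrix {K : Type*} [Field K] (n : ℕ) (σ : K ≃+* K) (c : K)
    (x : Fin n → K) : Matrix (Fin n) (Fin n) K :=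
  fun r k => ∑ i : Fin n,
    if ((i : ℕ) + (k : ℕ)) % n = (r : ℕ) then
      c ^ (((i : ℕ) + (k : ℕ)) / n) * (σ ^ (k : ℕ)) (x i)
    else 0

lemma sum_ite_mod_eq {M : Type*} [AddCommMonoid M] {n : ℕ} (hn : 0 < n) (a : ℕ)
    (f : ℕ → M) :
    (∑ s : Fin n, if a % n = (s : ℕ) then f s else 0) = f (a % n) := by
  rw [Finset.sum_eq_single (⟨a % n, Nat.mod_lt a hn⟩ : Fin n)]
  · simp
  · intro s _ hs
    rw [if_neg fun h => hs (Fin.ext h.symm)]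
  · simp

lemma add_div_add_mod_add_div {n : ℕ} (hn : 0 < n) (a b : ℕ) :
    a / n + (a % n + b) / n = (a + b) / n := by
  conv_rhs => rw [← Nat.div_add_mod a n, add_assoc, Nat.mul_add_div hn]

lemma pow_apply_of_apply_eq {K : Type*} [Field K] {σ : K ≃+* K} {c : K} (h : σ c = c) (k : ℕ) :
    (σ ^ k) c = c := by
  induction k with
  | zero => simp
  | succ k ih => rw [pow_succ, RingAut.mul_apply, h, ih]

theorem cycMatrix_cycMul {K : Type*} [Field K] {n : ℕ} (hn : 0 < n) {σ : K ≃+* K}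
    (hσ : σ ^ n = 1) {c : K} (hc : σ c = c) (x y : Fin n → K) :
    cycMatrix n σ c (cycMul n σ c x y) = cycMatrix n σ c x * cycMatrix n σ c y := by
  ext r k
  have hσmod : ∀ a : ℕ, σ ^ (a % n) = σ ^ a := fun a => by
    conv_rhs => rw [← Nat.mod_add_div a n, pow_add, pow_mul, hσ, one_pow, mul_one]
  have hl : cycMatrix n σ c (cycMul n σ c x y) r k = ∑ i : Fin n, ∑ j : Fin n,
      if ((i : ℕ) + j + k) % n = r then
        c ^ (((i : ℕ) + j + k) / n) * (σ ^ ((j : ℕ) + k)) (x i) * (σ ^ (k : ℕ)) (y j)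
      else 0 := by
    have hs : ∀ s : Fin n,
        (if ((s : ℕ) + k) % n = r then
          c ^ (((s : ℕ) + k) / n) * (σ ^ (k : ℕ)) (cycMul n σ c x y s) else 0) =
        ∑ i : Fin n, ∑ j : Fin n, if ((i : ℕ) + j) % n = s then
          (if ((s : ℕ) + k) % n = r then c ^ (((i : ℕ) + j) / n + ((s : ℕ) + k) / n) *
            (σ ^ ((j : ℕ) + k)) (x i) * (σ ^ (k : ℕ)) (y j) else 0) else 0 := by
      intro s
      split_ifs
      · simp only [cycMul, map_sum, Finset.mul_sum]
        refine Finset.sum_congr rfl fun i _ => Finset.sum_congr rfl fun j _ => ?_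
        split_ifs
        · simp only [map_mul, map_pow, pow_apply_of_apply_eq hc]
          rw [add_comm (j : ℕ) k, pow_add, pow_add, RingAut.mul_apply]
          ring
        · simp
      · simp
    simp only [cycMatrix]
    rw [Finset.sum_congr rfl fun s _ => hs s, Finset.sum_comm]
    refine Finset.sum_congr rfl fun i _ => ?_
    rw [Finset.sum_comm]
    refine Finset.sum_congr rfl fun j _ => ?_
    rw [sum_ite_mod_eq hn ((i : ℕ) + j) fun s => if (s + k) % n = r then
      c ^ (((i : ℕ) + j) / n + (s + k) / n) *
            (σ ^ ((j : ℕ) + k)) (x i) * (σ ^ (k : ℕ)) (y j) else 0]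
    rw [add_div_add_mod_add_div hn, Nat.mod_add_mod]
  have hr : (cycMatrix n σ c x * cycMatrix n σ c y) r k = ∑ i : Fin n, ∑ j : Fin n,
      if ((i : ℕ) + j + k) % n = r then
        c ^ (((i : ℕ) + j + k) / n) * (σ ^ ((j : ℕ) + k)) (x i) * (σ ^ (k : ℕ)) (y j)
      else 0 := by
    have ht : ∀ t : Fin n, cycMatrix n σ c x r t * cycMatrix n σ c y t k =
        ∑ i : Fin n, ∑ j : Fin n, if ((j : ℕ) + k) % n = t then
          (if ((i : ℕ) + t) % n = r then c ^ (((j : ℕ) + k) / n + (t + i : ℕ) / n) *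
            (σ ^ (t : ℕ)) (x i) * (σ ^ (k : ℕ)) (y j) else 0) else 0 := by
      intro t
      simp only [cycMatrix, Finset.sum_mul_sum]
      refine Finset.sum_congr rfl fun i _ => Finset.sum_congr rfl fun j _ => ?_
      split_ifs
      · rw [pow_add, add_comm (t : ℕ) i]
        ring
      all_goals simp
    rw [Matrix.mul_apply, Finset.sum_congr rfl fun t _ => ht t, Finset.sum_comm]
    refine Finset.sum_congr rfl fun i _ => ?_
    rw [Finset.sum_comm]
    refine Finset.sum_congr rfl fun j _ => ?_
    rw [sum_ite_mod_eq hn ((j : ℕ) + k) fun t => if ((i : ℕ) + t) % n = r then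
      c ^ (((j : ℕ) + k) / n + (t + i) / n) *
            (σ ^ t) (x i) * (σ ^ (k : ℕ)) (y j) else 0]
    rw [add_div_add_mod_add_div hn, Nat.add_mod_mod, hσmod, ← add_assoc,
      add_comm ((j : ℕ) + k) i, ← add_assoc]
  rw [hl, hr]

theorem cycMatrix_map {K : Type*} [Field K] (n : ℕ) {σ ρ : K ≃+* K} (h : Commute σ ρ)
    {c : K} (hc : ρ c = c) (x : Fin n → K) :
    cycMatrix n σ c (fun i => ρ (x i)) = (cycMatrix n σ c x).map ρ := by
  ext r k
  simp only [cycMatrix, Matrix.map_apply, map_sum]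
  refine Finset.sum_congr rfl fun i _ => ?_
  split_ifs
  · rw [map_mul, map_pow, hc, ← RingAut.mul_apply, ← RingAut.mul_apply,
      (h.pow_left (k : ℕ)).eq]
  · simp

theorem cycMatrix_delta0 {K : Type*} [Field K] {n : ℕ} (hn : 0 < n) {σ : K ≃+* K} (c : K)
    {d : K} (hd : σ d = d) :
    cycMatrix n σ c (delta0 n d) = Matrix.scalar (Fin n) d := by
  ext r k
  rw [cycMatrix, Finset.sum_eq_single (⟨0, hn⟩ : Fin n)]
  · simp [delta0, Nat.mod_eq_of_lt k.2, Nat.div_eq_of_lt k.2, pow_apply_of_apply_eq hd,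
      Matrix.diagonal_apply, Fin.ext_iff, eq_comm]
  · intro i _ hi
    have hi' : (i : ℕ) ≠ 0 := fun h => hi (Fin.ext h)
    simp [delta0, hi']
  · simp

theorem det_cycMatrix_zProd {K : Type*} [Field K] {n : ℕ} (hn : 0 < n) {σ τ : K ≃+* K}
    (hσ : σ ^ n = 1) (hcomm : Commute σ τ) {c : K} (hcσ : σ c = c) (hcτ : τ c = c)
    (z : Fin n → K) (j : ℕ) :
    (cycMatrix n σ c (zProd n σ τ c z j)).det =
      ∏ i ∈ Finset.range j, (τ ^ i) (cycMatrix n σ c z).det := by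
  induction j with
  | zero => rw [zProd, cycMatrix_delta0 hn c (map_one σ)]; simp
  | succ j ih =>
    rw [zProd, cycMatrix_cycMul hn hσ hcσ, Matrix.det_mul, ih, Finset.prod_range_succ,
      cycMatrix_map n (hcomm.pow_right j) (pow_apply_of_apply_eq hcτ j), RingEquiv.map_det]
    rfl

theorem apply_prod_range_pow {K : Type*} [Field K] {τ : K ≃+* K} {m : ℕ} (hτ : τ ^ m = 1)
    (a : K) :
    τ (∏ i ∈ Finset.range m, (τ ^ i) a) = ∏ i ∈ Finset.range m, (τ ^ i) a := by
  rcases m with _ | m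
  · simp
  · rw [map_prod]
    simp only [← RingAut.mul_apply, ← pow_succ']
    rw [Finset.prod_range_succ, hτ, Finset.prod_range_succ' (fun i => (τ ^ i) a), pow_zero]


/-- Let `d ∈ F^×`. If `τ(dⁿ) ≠ dⁿ`, then
`d ≠ z·τ̃(z)·τ̃²(z)⋯τ̃^{m−1}(z)` for all `z ∈ D = (K/F,σ,c)`. -/
theorem norm_condition_of_tau_ne {K : Type*} [Field K] (n m : ℕ)
    (hn : 0 < n) (hm : 0 < m)
    (σ τ : K ≃+* K) (hσord : orderOf σ = n) (hτord : orderOf τ = m)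
    (hcomm : σ * τ = τ * σ)
    (hindep : ∀ i j : ℕ, i < n → j < m → σ ^ i * τ ^ j = 1 → i = 0 ∧ j = 0)
    (c : K) (hc0 : c ≠ 0) (hcσ : σ c = c) (hcτ : τ c = c)
    (d : K) (hd0 : d ≠ 0) (hdσ : σ d = d)
    (hdn : τ (d ^ n) ≠ d ^ n) :
    ∀ z : Fin n → K, delta0 n d ≠ zProd n σ τ c z m := by
  intro z hz
  have hdet := det_cycMatrix_zProd hn (hσord ▸ pow_orderOf_eq_one σ) hcomm hcσ hcτ z m
  rw [← hz, cycMatrix_delta0 hn c hdσ] at hdet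
  have hpow : d ^ n = ∏ i ∈ Finset.range m, (τ ^ i) (cycMatrix n σ c z).det := by
    simpa using hdet
  exact hdn (by rw [hpow, apply_prod_range_pow (hτord ▸ pow_orderOf_eq_one τ)])
end

section
/- Let K be a field, τ a field automorphism of K with τ^m = id, n ≥ 1, and d ∈ K. If there exists a matrix Z ∈ Mat_n(K) such that Z · Z^τ · Z^{τ²} ⋯ Z^{τ^{m−1}} = d·I_n, where Z^{τⁱ} denotes the matrix obtained by applying τⁱ to each entry of Z, then τ(dⁿ) = dⁿ. -/
/-- The norm `∏ i < m, τ^i x` is fixed by `τ` whenever `τ ^ m = 1`. -/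
theorem RingEquiv.map_prod_range_pow_apply {R : Type*} [CommRing R] (τ : R ≃+* R) {m : ℕ}
    (hm : 0 < m) (hτ : τ ^ m = 1) (x : R) :
    τ (∏ i ∈ Finset.range m, (τ ^ i) x) = ∏ i ∈ Finset.range m, (τ ^ i) x := by
  obtain ⟨k, rfl⟩ := Nat.exists_eq_succ_of_ne_zero hm.ne'
  have h (i : ℕ) : τ ((τ ^ i) x) = (τ ^ (i + 1)) x := by
    rw [pow_succ']; rfl
  simp_rw [map_prod, h]
  rw [Finset.prod_range_succ, Finset.prod_range_succ', hτ, pow_zero]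

/-- Let `K` be a field, `τ` a field automorphism of `K` with `τ^m = id`,
`n ≥ 1`, and `d ∈ K`. If there exists `Z ∈ Mat_n(K)` such that
`Z · Z^τ · Z^{τ²} ⋯ Z^{τ^{m−1}} = d·I_n` (where `Z^{τⁱ}` applies `τⁱ` entrywise),
then `τ(dⁿ) = dⁿ`. -/
theorem tau_fixes_det_pow {K : Type*} [Field K] (m n : ℕ) (hm : 0 < m) (hn : 1 ≤ n)
    (τ : K ≃+* K) (hτ : τ ^ m = 1) (d : K)
    (Z : Matrix (Fin n) (Fin n) K)
    (hZ : ((List.range m).map fun i => Z.map ⇑(τ ^ i)).prod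
        = d • (1 : Matrix (Fin n) (Fin n) K)) :
    τ (d ^ n) = d ^ n := by
  have hdet : d ^ n = ∏ i ∈ Finset.range m, (τ ^ i) Z.det := by
    have h := congrArg Matrix.detMonoidHom hZ
    rw [map_list_prod, List.map_map] at h
    simp only [Matrix.coe_detMonoidHom, Matrix.det_smul, Matrix.det_one, mul_one,
      Fintype.card_fin] at h
    rw [← h, Finset.prod_eq_multiset_prod, Finset.range_val, Multiset.range, Multiset.map_coe,
      Multiset.prod_coe]
    congr 1
    refine List.map_congr_left fun i _ => ?_
    exact ((τ ^ i).map_det Z).symm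
  rw [hdet, τ.map_prod_range_pow_apply hm hτ]
end
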